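/- arXiv:2507.23688 — 2 statements merged into one kernel-verified Lean document; each statement's English description precedes it below -/
import Mathlib

section
/- Let d ≥ 1, let U be a bounded domain in ℂ^d, let x ∈ closure(U), let p > 2d/(2d−1) and q = p/(p−1). If ∑_{n=1}^∞ 2^{n(2d−1)q} Γ_q(A_n(x) \ U) < ∞, then there exists a constant C > 0 such that |f(x)| ≤ C (∫_U |f|^p dV)^{1/p} for every function f analytic on a neighborhood of closure(U). -/
open MeasureTheory
open scoped ENNReal

noncomputable instance (d : ℕ) : MeasurableSpace (EuclideanSpace ℂ (Fin d)) := borel _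
instance (d : ℕ) : BorelSpace (EuclideanSpace ℂ (Fin d)) := ⟨rfl⟩

/-- The Sobolev `q`-capacity of a compact set `K`: the infimum of `∫ |∇u|^q dV` over all
Lipschitz functions `u` with compact support satisfying `u ≥ 1` on `K`.  (At points where a
Lipschitz function is not differentiable, `fderiv` takes the junk value `0`; by Rademacher's
theorem this agrees a.e. with the gradient.) -/
noncomputable def capCompact {E : Type*} [NormedAddCommGroup E] [NormedSpace ℝ E]
    [MeasureSpace E] (q : ℝ) (K : Set E) : ℝ :=
  sInf { t : ℝ | ∃ u : E → ℝ, (∃ L, LipschitzWith L u) ∧ HasCompactSupport u ∧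
    (∀ z ∈ K, 1 ≤ u z) ∧ t = ∫ z, ‖fderiv ℝ u z‖ ^ q }

/-- The Sobolev `q`-capacity of an arbitrary set: the supremum of the capacities of its
compact subsets (with value in `ℝ≥0∞`). -/
noncomputable def sobolevCapacity {E : Type*} [NormedAddCommGroup E] [NormedSpace ℝ E]
    [MeasureSpace E] (q : ℝ) (A : Set E) : ℝ≥0∞ :=
  ⨆ (K : Set E) (_ : IsCompact K) (_ : K ⊆ A), ENNReal.ofReal (capCompact q K)

/-- The spherical shell (higher-dimensional annulus) `A_n(x) = {z : 2^{-(n+1)} < |z-x| < 2^{-n}}`. -/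
def shell {d : ℕ} (x : EuclideanSpace ℂ (Fin d)) (n : ℕ) : Set (EuclideanSpace ℂ (Fin d)) :=
  {z | (2 : ℝ) ^ (-((n : ℤ) + 1)) < dist z x ∧ dist z x < (2 : ℝ) ^ (-(n : ℤ))}

section LipschitzCalculus

open Metric Set Filter Topology

variable {E : Type*} [NormedAddCommGroup E] {F : Type*} [NormedAddCommGroup F]

/-- A function is Lipschitz near a point if it is Lipschitz on some neighborhood of it. -/
def LipschitzNear (g : E → F) (z : E) : Prop :=
  ∃ K, ∃ t ∈ 𝓝 z, LipschitzOnWith K g t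

lemma LipschitzNear.congr {g h : E → F} {z : E} (hg : LipschitzNear g z) (hgh : h =ᶠ[𝓝 z] g) :
    LipschitzNear h z := by
  obtain ⟨K, t, ht, hK⟩ := hg
  refine ⟨K, t ∩ {y | h y = g y}, inter_mem ht hgh, fun a ha b hb => ?_⟩
  rw [ha.2, hb.2]
  exact hK ha.1 hb.1

lemma LipschitzWith.lipschitzNear {g : E → F} {K : NNReal} (hg : LipschitzWith K g) (z : E) :
    LipschitzNear g z :=
  ⟨K, univ, univ_mem, hg.lipschitzOnWith⟩

lemma ContDiff.lipschitzNear [NormedSpace ℝ E] [NormedSpace ℝ F] {g : E → F}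
    (hg : ContDiff ℝ 1 g) (z : E) : LipschitzNear g z :=
  hg.contDiffAt.exists_lipschitzOnWith

lemma LipschitzNear.smul [NormedSpace ℝ F] {c : E → ℝ} {g : E → F} {z : E}
    (hc : LipschitzNear c z) (hg : LipschitzNear g z) :
    LipschitzNear (fun y => c y • g y) z := by
  obtain ⟨K, t, ht, hK⟩ := hc
  obtain ⟨K', t', ht', hK'⟩ := hg
  have h1 : LipschitzOnWith (max K K') (fun y => (c y, g y)) (t ∩ t') :=
    (hK.mono inter_subset_left).prodMk (hK'.mono inter_subset_right)
  have h2 : ContDiff ℝ 1 (fun p : ℝ × F => p.1 • p.2) := contDiff_fst.smul contDiff_snd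
  obtain ⟨L, s, hs, hL⟩ := h2.lipschitzNear (c z, g z)
  have hcont : ContinuousAt (fun y => (c y, g y)) z :=
    h1.continuousOn.continuousAt (inter_mem ht ht')
  refine ⟨L * max K K', (t ∩ t') ∩ (fun y => (c y, g y)) ⁻¹' s,
    inter_mem (inter_mem ht ht') (hcont hs), ?_⟩
  exact hL.comp (h1.mono inter_subset_left) (fun y hy => hy.2)

lemma exists_lipschitzWith_of_lipschitzNear [ProperSpace E] {g : E → F}
    (hg : ∀ z, LipschitzNear g z) (hsupp : HasCompactSupport g) : ∃ K, LipschitzWith K g := by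
  have hcont : Continuous g := by
    refine continuous_iff_continuousAt.2 fun z => ?_
    obtain ⟨K, t, ht, hK⟩ := hg z
    exact hK.continuousOn.continuousAt ht
  have hcomp : IsCompact (cthickening 1 (tsupport g)) := hsupp.isCompact.cthickening
  obtain ⟨K, hK⟩ := LocallyLipschitzOn.exists_lipschitzOnWith_of_compact hcomp (f := g) (by
    intro z _
    obtain ⟨K, t, ht, hK⟩ := hg z
    exact ⟨K, t, mem_nhdsWithin_of_mem_nhds ht, hK⟩)
  obtain ⟨M, hM⟩ := hsupp.exists_bound_of_continuous hcont
  have hM0 : 0 ≤ M := (norm_nonneg _).trans (hM 0)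
  have key : ∀ a ∈ tsupport g, ∀ b, dist (g a) (g b) ≤ max K M.toNNReal * dist a b := by
    intro a ha b
    by_cases hb : b ∈ cthickening 1 (tsupport g)
    · refine (hK.dist_le_mul a (self_subset_cthickening _ ha) b hb).trans ?_
      gcongr
      exact_mod_cast le_max_left _ _
    · have h0 : g b = 0 := by
        by_contra h
        exact hb (self_subset_cthickening _ (subset_tsupport _ h))
      have h1 : 1 ≤ dist a b := by
        by_contra! h
        exact hb (mem_cthickening_of_dist_le b a 1 _ ha (by rw [dist_comm]; exact h.le))
      rw [h0, dist_zero_right]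
      calc ‖g a‖ ≤ M * 1 := by simpa using hM a
        _ ≤ max K M.toNNReal * dist a b := by
          gcongr
          push_cast
          exact (Real.le_coe_toNNReal M).trans (le_max_right _ _)
  refine ⟨max K M.toNNReal, LipschitzWith.of_dist_le_mul fun a b => ?_⟩
  push_cast
  push_cast at key
  by_cases ha : a ∈ tsupport g
  · exact key a ha b
  by_cases hb : b ∈ tsupport g
  · rw [dist_comm (g a), dist_comm a]
    exact key b hb a
  · rw [image_eq_zero_of_notMem_tsupport ha, image_eq_zero_of_notMem_tsupport hb, dist_self]
    positivity

end LipschitzCalculus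

section IntegrationByParts

open Metric Set Filter Topology

variable {E : Type*} [NormedAddCommGroup E] {F : Type*} [NormedAddCommGroup F]

lemma integrable_of_norm_le_of_eq_zero [MeasurableSpace E] {μ : Measure E}
    [IsFiniteMeasureOnCompacts μ] {g : E → F}
    (hg : AEStronglyMeasurable g μ) {K : Set E} (hK : IsCompact K) (C : ℝ)
    (hC : ∀ z, ‖g z‖ ≤ C) (h0 : ∀ z ∉ K, g z = 0) : Integrable g μ := by
  rw [← integrableOn_iff_integrable_of_support_subset (s := K)
    (fun z hz => by by_contra h; exact hz (h0 z h))]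
  exact IntegrableOn.of_bound hK.measure_lt_top hg.restrict C (.of_forall hC)

lemma fderiv_eq_zero_of_notMem_tsupport [NormedSpace ℝ E] [NormedSpace ℝ F] {g : E → F} {z : E}
    (hz : z ∉ tsupport g) : fderiv ℝ g z = 0 := by
  by_contra h
  exact hz (support_fderiv_subset ℝ h)

variable [MeasurableSpace E] [BorelSpace E] [InnerProductSpace ℝ E] [FiniteDimensional ℝ E]
  [NormedSpace ℝ F] [FiniteDimensional ℝ F]
  {μ : Measure E}

lemma aestronglyMeasurable_fderiv_apply (g : E → F) (v : E → E) (hv : Continuous v) :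
    AEStronglyMeasurable (fun z => fderiv ℝ g z (v z)) μ := by
  have : CompleteSpace F := FiniteDimensional.complete ℝ F
  have h1 : StronglyMeasurable (fderiv ℝ g) := (measurable_fderiv ℝ g).stronglyMeasurable
  exact (isBoundedBilinearMap_apply.continuous.comp_stronglyMeasurable
    (h1.prodMk hv.stronglyMeasurable)).aestronglyMeasurable

variable [μ.IsAddHaarMeasure]

lemma integral_fderiv_apply_const_real {g : E → ℝ} {K : NNReal} (hg : LipschitzWith K g)
    (hsupp : HasCompactSupport g) (v : E) : ∫ z, fderiv ℝ g z v ∂μ = 0 := by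
  have h := LipschitzWith.integral_lineDeriv_mul_eq (μ := μ) (LipschitzWith.const (1 : ℝ)) hg hsupp
    (-v)
  have h1 : ∀ z : E, lineDeriv ℝ (fun _ : E => (1 : ℝ)) z (-v) = 0 := fun z => by simp [lineDeriv]
  simp only [h1, zero_mul, integral_zero, neg_neg, mul_one] at h
  rw [h]
  refine integral_congr_ae ?_
  filter_upwards [hg.ae_differentiableAt] with z hz
  exact hz.lineDeriv_eq_fderiv.symm

lemma integrable_fderiv_apply {g : E → F} {K : NNReal} (hg : LipschitzWith K g)
    (hsupp : HasCompactSupport g) {v : E → E} (hv : Continuous v) :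
    Integrable (fun z => fderiv ℝ g z (v z)) μ := by
  obtain ⟨C, hC⟩ := hsupp.isCompact.exists_bound_of_continuousOn hv.continuousOn
  refine integrable_of_norm_le_of_eq_zero (aestronglyMeasurable_fderiv_apply g v hv)
    hsupp.isCompact (K * |C|) (fun z => ?_) (fun z hz => ?_)
  · by_cases hz : z ∈ tsupport g
    · exact (ContinuousLinearMap.le_opNorm _ _).trans (mul_le_mul (norm_fderiv_le_of_lipschitz ℝ hg)
        ((hC z hz).trans (le_abs_self _)) (norm_nonneg _) K.2)
    · rw [fderiv_eq_zero_of_notMem_tsupport hz]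
      simp only [zero_apply, norm_zero]
      positivity
  · rw [fderiv_eq_zero_of_notMem_tsupport hz]
    simp

lemma integral_fderiv_apply_const {g : E → F} {K : NNReal} (hg : LipschitzWith K g)
    (hsupp : HasCompactSupport g) (v : E) : ∫ z, fderiv ℝ g z v ∂μ = 0 := by
  have : CompleteSpace F := FiniteDimensional.complete ℝ F
  refine SeparatingDual.eq_zero_of_forall_dual_eq_zero (R := ℝ) fun ℓ => ?_
  rw [← ℓ.integral_comp_comm (integrable_fderiv_apply hg hsupp continuous_const)]
  rw [← integral_fderiv_apply_const_real (μ := μ) (ℓ.lipschitz.comp hg)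
    (hsupp.comp_left (g := ℓ) (map_zero ℓ)) v]
  refine integral_congr_ae ?_
  filter_upwards [hg.ae_differentiableAt] with z hz
  rw [fderiv_comp z ℓ.differentiableAt hz]
  simp

/-- Integration by parts against a linear vector field: the divergence of `z ↦ A (z - x)` is the
trace of `A`. -/
lemma integral_fderiv_apply_linear {g : E → F} {K : NNReal} (hg : LipschitzWith K g)
    (hsupp : HasCompactSupport g) (x : E) (A : E →L[ℝ] E) {ι : Type*} [Fintype ι]
    (b : OrthonormalBasis ι ℝ E) :
    ∫ z, fderiv ℝ g z (A (z - x)) ∂μ = -((∑ i, inner ℝ (b i) (A (b i))) • ∫ z, g z ∂μ) := by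
  have : CompleteSpace F := FiniteDimensional.complete ℝ F
  let ℓ : ι → E →L[ℝ] ℝ := fun i => (innerSL ℝ (b i)) ∘L A
  have hcd : ∀ i, ContDiff ℝ 1 (fun z => ℓ i (z - x)) := fun i =>
    (ℓ i).contDiff.comp (contDiff_id.sub contDiff_const)
  have hint : Integrable g μ := hg.continuous.integrable_of_hasCompactSupport hsupp
  have hℓc : ∀ i, Continuous fun z => ℓ i (z - x) := fun i => (hcd i).continuous
  have hi : ∀ i, ∫ z, (ℓ i (z - x) • fderiv ℝ g z (b i) + ℓ i (b i) • g z) ∂μ = 0 := by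
    intro i
    have hs : HasCompactSupport fun z => ℓ i (z - x) • g z := hsupp.smul_left
    obtain ⟨L, hL⟩ := exists_lipschitzWith_of_lipschitzNear
      (fun z => ((hcd i).lipschitzNear z).smul (hg.lipschitzNear z)) hs
    rw [← integral_fderiv_apply_const (μ := μ) hL hs (b i)]
    refine integral_congr_ae ?_
    filter_upwards [hg.ae_differentiableAt] with z hz
    have h1 : HasFDerivAt (fun z => ℓ i (z - x)) (ℓ i) z :=
      (ℓ i).hasFDerivAt.comp z ((hasFDerivAt_id z).sub_const x)
    have h2 := (h1.smul hz.hasFDerivAt).fderiv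
    have h3 : (fun z => ℓ i (z - x)) • g = fun z => ℓ i (z - x) • g z := rfl
    rw [h3] at h2
    rw [h2]
    simp
  have hint1 : ∀ i, Integrable (fun z => ℓ i (z - x) • fderiv ℝ g z (b i)) μ := by
    intro i
    have := integrable_fderiv_apply (μ := μ) hg hsupp (v := fun z => ℓ i (z - x) • b i)
      ((hℓc i).smul continuous_const)
    simpa using this
  have hi2 : ∀ i, ∫ z, ℓ i (z - x) • fderiv ℝ g z (b i) ∂μ = -(ℓ i (b i) • ∫ z, g z ∂μ) := by
    intro i
    have := hi i
    rw [integral_add (hint1 i) (hint.fun_smul _), integral_smul] at this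
    exact eq_neg_of_add_eq_zero_left this
  have hsum : ∀ z, fderiv ℝ g z (A (z - x)) = ∑ i, ℓ i (z - x) • fderiv ℝ g z (b i) := by
    intro z
    conv_lhs => rw [← b.sum_repr' (A (z - x))]
    simp [ℓ]
  simp_rw [hsum]
  rw [integral_finsetSum _ (fun i _ => hint1 i)]
  simp_rw [hi2]
  rw [Finset.sum_neg_distrib, Finset.sum_smul]
  rfl

end IntegrationByParts

section Kernel

open Metric Set Filter Topology

variable {E : Type*} [NormedAddCommGroup E] [InnerProductSpace ℝ E]

lemma hasFDerivAt_norm_sq_add_rpow {ε : ℝ} (hε : 0 < ε) (s : ℝ) (x z : E) :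
    HasFDerivAt (fun z => (‖z - x‖ ^ 2 + ε ^ 2) ^ s)
      ((s * (‖z - x‖ ^ 2 + ε ^ 2) ^ (s - 1)) • ((2 : ℝ) • innerSL ℝ (z - x))) z := by
  have h1 : HasFDerivAt (fun z => ‖z - x‖ ^ 2 + ε ^ 2) ((2 : ℝ) • innerSL ℝ (z - x)) z := by
    refine ((((hasFDerivAt_id (𝕜 := ℝ) z).sub_const x).norm_sq).add_const (ε ^ 2)).congr_fderiv ?_
    ext v
    simp [two_smul]
  exact h1.rpow_const (Or.inl (by positivity))

lemma contDiff_norm_sq_add_rpow {ε : ℝ} (hε : 0 < ε) (s : ℝ) (x : E) :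
    ContDiff ℝ 1 (fun z => (‖z - x‖ ^ 2 + ε ^ 2) ^ s) := by
  refine ContDiff.rpow_const_of_ne ?_ (fun z => by positivity)
  exact ((contDiff_id.sub contDiff_const).norm_sq ℝ).add contDiff_const

end Kernel

section Hardy

open Metric Set Filter Topology

variable {E : Type*} [NormedAddCommGroup E] [InnerProductSpace ℝ E]

lemma rpow_sub_one_mul_le {q θ a b : ℝ} (hq : 1 < q) (hθ : 0 < θ) (ha : 0 ≤ a) (hb : 0 ≤ b) :
    a ^ (q - 1) * b ≤ θ * a ^ q + θ ^ (1 - q) * b ^ q := by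
  rcases le_or_gt b (θ * a) with h | h
  · have h1 : a ^ (q - 1) * b ≤ θ * a ^ q := by
      calc a ^ (q - 1) * b ≤ a ^ (q - 1) * (θ * a) := by gcongr
        _ = θ * (a ^ (q - 1) * a ^ (1 : ℝ)) := by rw [Real.rpow_one]; ring
        _ = θ * a ^ q := by
          rw [← Real.rpow_add_of_nonneg ha (by linarith) (by norm_num)]; norm_num
    have : 0 ≤ θ ^ (1 - q) * b ^ q := by positivity
    linarith
  · have hab : a ≤ θ⁻¹ * b := by
      rw [inv_mul_eq_div, le_div_iff₀ hθ]; linarith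
    have h1 : a ^ (q - 1) * b ≤ θ ^ (1 - q) * b ^ q := by
      calc a ^ (q - 1) * b ≤ (θ⁻¹ * b) ^ (q - 1) * b := by
            gcongr
        _ = θ ^ (1 - q) * (b ^ (q - 1) * b ^ (1 : ℝ)) := by
          rw [Real.mul_rpow (by positivity) hb, Real.inv_rpow hθ.le, ← Real.rpow_neg hθ.le,
            Real.rpow_one]
          ring_nf
        _ = θ ^ (1 - q) * b ^ q := by
          rw [← Real.rpow_add_of_nonneg hb (by linarith) (by norm_num)]; norm_num
    have : 0 ≤ θ * a ^ q := by positivity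
    linarith

lemma LipschitzNear.comp_contDiff {E : Type*} [NormedAddCommGroup E] {h : ℝ → ℝ} (hh : ContDiff ℝ 1 h)
    {u : E → ℝ} {K : NNReal}
    (hu : LipschitzWith K u) (z : E) : LipschitzNear (fun y => h (u y)) z := by
  obtain ⟨L, s, hs, hL⟩ := hh.lipschitzNear (u z)
  exact ⟨L * K, u ⁻¹' s, hu.continuous.continuousAt hs,
    hL.comp hu.lipschitzOnWith (fun y hy => hy)⟩

/-- The pointwise estimate behind the Hardy inequality. -/
lemma hardy_pointwise {q n m r D t d : ℝ} (hq : 1 < q) (hqn : q < n) (hm0 : 0 < m)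
    (hrm : r ^ 2 ≤ m) (hD0 : 0 ≤ D) (hD : |d| ≤ D * r) :
    (n - q) / 2 * (m ^ (-(q / 2)) * |t| ^ q) - q * ((n - q) / (2 * q)) ^ (1 - q) * D ^ q ≤
      m ^ (-(q / 2)) * (q * |t| ^ (q - 2) * t * d) - q * (m ^ (-(q / 2) - 1) * r ^ 2 * |t| ^ q) +
        n * (m ^ (-(q / 2)) * |t| ^ q) := by
  have hn : 0 < n - q := by linarith
  set θ : ℝ := (n - q) / (2 * q) with hθdef
  have hθ : 0 < θ := by positivity
  set b : ℝ := |t| * m ^ (-(1 / 2) : ℝ) with hb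
  have hb0 : 0 ≤ b := by positivity
  have hbq : b ^ q = m ^ (-(q / 2)) * |t| ^ q := by
    rw [hb, Real.mul_rpow (abs_nonneg _) (by positivity), ← Real.rpow_mul hm0.le, mul_comm]
    ring_nf
  have hr : r ≤ m ^ (1 / 2 : ℝ) := by
    rw [← Real.sqrt_eq_rpow]
    exact Real.le_sqrt_of_sq_le hrm
  have hfirst : |m ^ (-(q / 2)) * (q * |t| ^ (q - 2) * t * d)| ≤
      q * (b ^ (q - 1) * D) := by
    have e1 : |(|t| ^ (q - 2) * t)| = |t| ^ (q - 1) := by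
      rw [abs_mul, abs_of_nonneg (by positivity : 0 ≤ |t| ^ (q - 2))]
      rcases eq_or_ne (t) 0 with h | h
      · simp [h, Real.zero_rpow (by linarith : q - 1 ≠ 0)]
      · rw [← Real.rpow_add_one (by positivity)]
        ring_nf
    have e2 : b ^ (q - 1) = |t| ^ (q - 1) * (m ^ (-(q / 2)) * m ^ (1 / 2 : ℝ)) := by
      rw [hb, Real.mul_rpow (abs_nonneg _) (by positivity), ← Real.rpow_mul hm0.le,
        ← Real.rpow_add hm0]
      ring_nf
    calc |m ^ (-(q / 2)) * (q * |t| ^ (q - 2) * t * d)|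
        = m ^ (-(q / 2)) * (q * (|(|t| ^ (q - 2) * t)| * |d|)) := by
          rw [abs_mul, abs_of_nonneg (by positivity : 0 ≤ m ^ (-(q / 2))),
            show q * |t| ^ (q - 2) * t * d =
              q * ((|t| ^ (q - 2) * t) * d) by ring,
            abs_mul, abs_of_nonneg (by linarith : 0 ≤ q), abs_mul]
      _ ≤ m ^ (-(q / 2)) * (q * (|t| ^ (q - 1) * (D * m ^ (1 / 2 : ℝ)))) := by
          rw [e1]
          gcongr
          exact hD.trans (by gcongr)
      _ = q * (b ^ (q - 1) * D) := by rw [e2]; ring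
  have hyoung := rpow_sub_one_mul_le hq hθ hb0 hD0
  have hsecond : m ^ (-(q / 2) - 1) * r ^ 2 ≤ m ^ (-(q / 2)) := by
    rw [Real.rpow_sub_one hm0.ne', div_mul_eq_mul_div, div_le_iff₀ hm0]
    gcongr
  have hsecond2 : m ^ (-(q / 2) - 1) * r ^ 2 * |t| ^ q ≤ b ^ q := by
    rw [hbq]; gcongr
  have hθq : q * θ = (n - q) / 2 := by rw [hθdef]; field_simp
  have hf2 := neg_le_of_abs_le hfirst
  rw [← hbq]
  have h5 : q * (b ^ (q - 1) * D) ≤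
      (n - q) / 2 * b ^ q + q * θ ^ (1 - q) * D ^ q := by
    calc _ ≤ q * (θ * b ^ q + θ ^ (1 - q) * D ^ q) := by gcongr
      _ = (q * θ) * b ^ q + q * θ ^ (1 - q) * D ^ q := by ring
      _ = _ := by rw [hθq]
  have h6 : q * (m ^ (-(q / 2) - 1) * r ^ 2 * |t| ^ q) ≤ q * b ^ q := by gcongr
  linarith

lemma hardy_fderiv_bound {q n : ℝ} (hq : 1 < q) (hqn : q < n) {u : E → ℝ} (x : E) {ε : ℝ}
    (hε : 0 < ε) {z : E} (hz : DifferentiableAt ℝ u z) :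
    (n - q) / 2 * ((‖z - x‖ ^ 2 + ε ^ 2) ^ (-(q / 2)) • |u z| ^ q) -
        q * ((n - q) / (2 * q)) ^ (1 - q) * ‖fderiv ℝ u z‖ ^ q ≤
      fderiv ℝ (fun z => (‖z - x‖ ^ 2 + ε ^ 2) ^ (-(q / 2)) • |u z| ^ q) z
        ((ContinuousLinearMap.id ℝ E) (z - x)) +
        n * ((‖z - x‖ ^ 2 + ε ^ 2) ^ (-(q / 2)) • |u z| ^ q) := by
  have h1 := hasFDerivAt_norm_sq_add_rpow hε (-(q / 2)) x z
  have h2 : HasFDerivAt (fun z => |u z| ^ q) ((q * |u z| ^ (q - 2) * u z) • fderiv ℝ u z) z :=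
    (hasDerivAt_abs_rpow (u z) hq).comp_hasFDerivAt z hz.hasFDerivAt
  have h3 : fderiv ℝ (fun z => (‖z - x‖ ^ 2 + ε ^ 2) ^ (-(q / 2)) • |u z| ^ q) z = _ :=
    (h1.smul h2).fderiv
  rw [h3]
  have hm0 : 0 < ‖z - x‖ ^ 2 + ε ^ 2 := by positivity
  have hrm : ‖z - x‖ ^ 2 ≤ ‖z - x‖ ^ 2 + ε ^ 2 := by nlinarith
  generalize ‖z - x‖ ^ 2 + ε ^ 2 = m at hm0 hrm
  have hD : |fderiv ℝ u z (z - x)| ≤ ‖fderiv ℝ u z‖ * ‖z - x‖ := (fderiv ℝ u z).le_opNorm _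
  have hp := hardy_pointwise (t := u z) hq hqn hm0 hrm (norm_nonneg _) hD
  rw [smul_eq_mul]
  refine hp.trans_eq ?_
  generalize z - x = w
  simp
  ring

lemma contDiff_abs_rpow {q : ℝ} (hq : 1 < q) : ContDiff ℝ 1 (fun t : ℝ => |t| ^ q) :=
  contDiff_norm_rpow hq

lemma exists_lipschitzWith_hardy [FiniteDimensional ℝ E] {q : ℝ} (hq : 1 < q) {u : E → ℝ}
    {K : NNReal}
    (hu : LipschitzWith K u) (hsupp : HasCompactSupport u) (x : E) {ε : ℝ} (hε : 0 < ε) :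
    ∃ L, LipschitzWith L (fun z => (‖z - x‖ ^ 2 + ε ^ 2) ^ (-(q / 2)) • |u z| ^ q) ∧
      HasCompactSupport (fun z => (‖z - x‖ ^ 2 + ε ^ 2) ^ (-(q / 2)) • |u z| ^ q) := by
  have habs := contDiff_abs_rpow hq
  have hsuppq : HasCompactSupport fun z => |u z| ^ q :=
    hsupp.comp_left (g := fun t : ℝ => |t| ^ q) (by simp [Real.zero_rpow (by linarith : q ≠ 0)])
  have hGs : HasCompactSupport (fun z => (‖z - x‖ ^ 2 + ε ^ 2) ^ (-(q / 2)) • |u z| ^ q) :=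
    HasCompactSupport.smul_left (f := fun z => (‖z - x‖ ^ 2 + ε ^ 2) ^ (-(q / 2))) hsuppq
  obtain ⟨L, hL⟩ := exists_lipschitzWith_of_lipschitzNear
    (fun z => ((contDiff_norm_sq_add_rpow hε (-(q / 2)) x).lipschitzNear z).smul
      (LipschitzNear.comp_contDiff habs hu z)) hGs
  exact ⟨L, hL, hGs⟩

variable [MeasurableSpace E] [BorelSpace E] (μ : Measure E)

lemma integrable_norm_fderiv_rpow [IsFiniteMeasureOnCompacts μ] {u : E → ℝ} {K : NNReal}
    (hu : LipschitzWith K u)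
    (hsupp : HasCompactSupport u) {q : ℝ} (hq : 0 < q) :
    Integrable (fun z => ‖fderiv ℝ u z‖ ^ q) μ := by
  refine integrable_of_norm_le_of_eq_zero
    ((measurable_fderiv ℝ u).norm.pow_const q).aestronglyMeasurable hsupp.isCompact
    ((K : ℝ) ^ q) (fun z => ?_) (fun z hz => ?_)
  · rw [Real.norm_of_nonneg (by positivity)]
    gcongr
    exact norm_fderiv_le_of_lipschitz ℝ hu
  · rw [fderiv_eq_zero_of_notMem_tsupport hz, norm_zero, Real.zero_rpow hq.ne']

variable [FiniteDimensional ℝ E] [μ.IsAddHaarMeasure]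

lemma integral_le_of_fderiv_bound {G k : E → ℝ} {L : NNReal} (hL : LipschitzWith L G)
    (hGs : HasCompactSupport G) (hk : Integrable k μ) {a c n : ℝ} (hn : n = Module.finrank ℝ E)
    (x : E) (key : ∀ᵐ z ∂μ, a * G z - c * k z ≤
      fderiv ℝ G z ((ContinuousLinearMap.id ℝ E) (z - x)) + n * G z) :
    a * ∫ z, G z ∂μ ≤ c * ∫ z, k z ∂μ := by
  have hGint : Integrable G μ := hL.continuous.integrable_of_hasCompactSupport hGs
  have hibp := integral_fderiv_apply_linear (μ := μ) hL hGs x (ContinuousLinearMap.id ℝ E)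
    (stdOrthonormalBasis ℝ E)
  have htr : ∑ i, inner ℝ (stdOrthonormalBasis ℝ E i)
      ((ContinuousLinearMap.id ℝ E) (stdOrthonormalBasis ℝ E i)) = n := by
    simp [hn]
  rw [htr] at hibp
  have hGD := integrable_fderiv_apply (μ := μ) hL hGs
    (v := fun z => (ContinuousLinearMap.id ℝ E) (z - x)) (by fun_prop)
  have hint := integral_mono_ae ((hGint.const_mul a).sub
    (hk.const_mul c)) (hGD.add (hGint.const_mul n)) key
  simp only [Pi.sub_apply, Pi.add_apply] at hint
  rw [integral_sub (hGint.const_mul a) (hk.const_mul c),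
    integral_add hGD (hGint.const_mul n), hibp, integral_const_mul, integral_const_mul,
    integral_const_mul, smul_eq_mul] at hint
  linarith

lemma hardy_bound {q n : ℝ} (hq : 1 < q) (hqn : q < n) (hn : n = Module.finrank ℝ E)
    {u : E → ℝ} {K : NNReal} (hu : LipschitzWith K u) (hsupp : HasCompactSupport u) (x : E)
    {ε : ℝ} (hε : 0 < ε) :
    Integrable (fun z => (‖z - x‖ ^ 2 + ε ^ 2) ^ (-(q / 2)) • |u z| ^ q) μ ∧
      (n - q) / 2 * ∫ z, (‖z - x‖ ^ 2 + ε ^ 2) ^ (-(q / 2)) • |u z| ^ q ∂μ ≤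
        q * ((n - q) / (2 * q)) ^ (1 - q) * ∫ z, ‖fderiv ℝ u z‖ ^ q ∂μ := by
  obtain ⟨L, hL, hGs⟩ := exists_lipschitzWith_hardy hq hu hsupp x hε
  refine ⟨hL.continuous.integrable_of_hasCompactSupport hGs, ?_⟩
  refine integral_le_of_fderiv_bound μ hL hGs
    (integrable_norm_fderiv_rpow μ hu hsupp (by linarith : 0 < q)) hn x ?_
  exact hu.ae_differentiableAt.mono fun z hz => hardy_fderiv_bound hq hqn x hε hz

/-- A Hardy inequality for compactly supported Lipschitz functions, with a regularized weight. -/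
lemma exists_hardy_bound {q : ℝ} (hq : 1 < q) (hqn : q < Module.finrank ℝ E) :
    ∃ C : ℝ, 0 ≤ C ∧ ∀ (u : E → ℝ) (K : NNReal), LipschitzWith K u → HasCompactSupport u →
      ∀ (x : E) (ε : ℝ), 0 < ε →
        Integrable (fun z => (‖z - x‖ ^ 2 + ε ^ 2) ^ (-(q / 2)) • |u z| ^ q) μ ∧
        ∫ z, (‖z - x‖ ^ 2 + ε ^ 2) ^ (-(q / 2)) • |u z| ^ q ∂μ ≤
          C * ∫ z, ‖fderiv ℝ u z‖ ^ q ∂μ := by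
  obtain ⟨n, hn⟩ : ∃ n : ℝ, n = (Module.finrank ℝ E : ℝ) := ⟨_, rfl⟩
  rw [← hn] at hqn
  have h0 : 0 < (n - q) / 2 := by linarith
  have hq0 : 0 ≤ q := by linarith
  have hC : 0 ≤ q * ((n - q) / (2 * q)) ^ (1 - q) :=
    mul_nonneg hq0 (Real.rpow_nonneg (div_nonneg (by linarith) (by linarith)) _)
  refine ⟨q * ((n - q) / (2 * q)) ^ (1 - q) / ((n - q) / 2), div_nonneg hC h0.le, ?_⟩
  intro u K hu hsupp x ε hε
  obtain ⟨hi, hb⟩ := hardy_bound μ hq hqn hn hu hsupp x hε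
  refine ⟨hi, ?_⟩
  rw [div_mul_eq_mul_div, le_div_iff₀ h0, mul_comm _ ((n - q) / 2)]
  exact hb

end Hardy

section CauchyRiemann

open Metric Set Filter Topology

variable {E : Type*} [NormedAddCommGroup E]

lemma lipschitzNear_smul_of_tsupport {χ : E → ℝ} {K : NNReal} (hχ : LipschitzWith K χ) {f : E → ℂ}
    (hf : ∀ z ∈ tsupport χ, LipschitzNear f z) (z : E) :
    LipschitzNear (fun z => χ z • f z) z := by
  by_cases hz : z ∈ tsupport χ
  · exact (hχ.lipschitzNear z).smul (hf z hz)
  · refine ((LipschitzWith.const (0 : ℂ)).lipschitzNear z).congr ?_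
    filter_upwards [notMem_tsupport_iff_eventuallyEq.1 hz] with y hy
    simp [hy]

lemma norm_mul_rpow_le {n : ℝ} (hn : 0 < n) {r : ℝ} (ε : ℝ) (hr : 0 ≤ r) :
    r * (r ^ 2 + ε ^ 2) ^ (-(n / 2)) ≤ r ^ (1 - n) := by
  rcases hr.eq_or_lt with rfl | hr
  · rw [zero_mul]; positivity
  calc r * (r ^ 2 + ε ^ 2) ^ (-(n / 2)) ≤ r * (r ^ 2) ^ (-(n / 2)) := by
        refine mul_le_mul_of_nonneg_left ?_ hr.le
        exact Real.rpow_le_rpow_of_nonpos (by positivity) (by nlinarith) (by linarith)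
    _ = r ^ (1 - n) := by
        rw [← Real.rpow_natCast, ← Real.rpow_mul hr.le, sub_eq_add_neg, Real.rpow_add hr,
          Real.rpow_one]
        congr 2
        push_cast; ring

variable [InnerProductSpace ℝ E]

/-- The Cauchy–Riemann equations make the singular part of the divergence identity cancel. -/
lemma cauchyRiemann_identity {J : E →L[ℝ] E} (hJ : ∀ v, inner ℝ v (J v) = 0) {χ : E → ℝ}
    {f : E → ℂ} (n : ℝ) (x : E) {ε : ℝ} (hε : 0 < ε) {z : E} (hχ : DifferentiableAt ℝ χ z)
    (hf : DifferentiableAt ℝ f z)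
    (hCR : ∀ v, fderiv ℝ f z (J v) = Complex.I * fderiv ℝ f z v) :
    (n * ε ^ 2 * (‖z - x‖ ^ 2 + ε ^ 2) ^ (-(n / 2) - 1)) • (χ z • f z) =
      n • ((‖z - x‖ ^ 2 + ε ^ 2) ^ (-(n / 2)) • (χ z • f z)) +
      fderiv ℝ (fun z => (‖z - x‖ ^ 2 + ε ^ 2) ^ (-(n / 2)) • (χ z • f z)) z
        ((ContinuousLinearMap.id ℝ E) (z - x)) +
      Complex.I * fderiv ℝ (fun z => (‖z - x‖ ^ 2 + ε ^ 2) ^ (-(n / 2)) • (χ z • f z)) z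
        (J (z - x)) -
      (‖z - x‖ ^ 2 + ε ^ 2) ^ (-(n / 2)) •
        (((fderiv ℝ χ z (z - x) : ℂ) + Complex.I * (fderiv ℝ χ z (J (z - x)) : ℂ)) * f z) := by
  have h1 := hasFDerivAt_norm_sq_add_rpow hε (-(n / 2)) x z
  have h3 : fderiv ℝ (fun z => (‖z - x‖ ^ 2 + ε ^ 2) ^ (-(n / 2)) • (χ z • f z)) z = _ :=
    (h1.smul (hχ.hasFDerivAt.smul hf.hasFDerivAt)).fderiv
  rw [h3]
  have hm0 : 0 < ‖z - x‖ ^ 2 + ε ^ 2 := by positivity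
  obtain ⟨m, hm⟩ : ∃ m, m = ‖z - x‖ ^ 2 + ε ^ 2 := ⟨_, rfl⟩
  have hw : inner ℝ (z - x) (z - x) = m - ε ^ 2 := by
    rw [real_inner_self_eq_norm_sq, hm]; ring
  rw [← hm] at hm0 ⊢
  have hpow : m ^ (-(n / 2)) = m ^ (-(n / 2) - 1) * m := by
    rw [Real.rpow_sub_one hm0.ne', div_mul_cancel₀ _ hm0.ne']
  have hCR' := hCR (z - x)
  have hJ' := hJ (z - x)
  generalize z - x = w at *
  generalize fderiv ℝ f z = A at *
  rw [hpow]
  generalize m ^ (-(n / 2) - 1) = P at *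
  simp only [add_apply, smul_apply, Pi.smul_apply',
    ContinuousLinearMap.smulRight_apply, ContinuousLinearMap.id_apply, innerSL_apply_apply, hw, hJ',
    hCR', Complex.real_smul, smul_eq_mul]
  push_cast
  ring_nf
  simp only [Complex.I_sq]
  ring

lemma enorm_smul_cauchyRiemann_le {J : E →L[ℝ] E} (hJn : ∀ v, ‖J v‖ ≤ ‖v‖) (D : E →L[ℝ] ℝ)
    (c : ℂ) {n : ℝ} (hn : 0 < n) (w : E) (ε : ℝ) :
    ‖(‖w‖ ^ 2 + ε ^ 2) ^ (-(n / 2)) • (((D w : ℂ) + Complex.I * (D (J w) : ℂ)) * c)‖ₑ ≤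
      2 * (‖c‖ₑ * ‖D‖ₑ * ENNReal.ofReal (‖w‖ ^ (1 - n))) := by
  have h1 : ‖D w‖ ≤ ‖D‖ * ‖w‖ := D.le_opNorm w
  have h2 : ‖D (J w)‖ ≤ ‖D‖ * ‖w‖ :=
    (D.le_opNorm _).trans (mul_le_mul_of_nonneg_left (hJn w) (norm_nonneg _))
  have h3 : ‖(D w : ℂ) + Complex.I * (D (J w) : ℂ)‖ ≤ 2 * (‖D‖ * ‖w‖) := by
    refine (norm_add_le _ _).trans ?_
    rw [norm_mul, Complex.norm_I, one_mul, Complex.norm_real, Complex.norm_real]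
    linarith
  have h4 := norm_mul_rpow_le hn ε (norm_nonneg w)
  have h5 : ‖(‖w‖ ^ 2 + ε ^ 2) ^ (-(n / 2)) • (((D w : ℂ) + Complex.I * (D (J w) : ℂ)) * c)‖ ≤
      2 * (‖c‖ * ‖D‖ * ‖w‖ ^ (1 - n)) := by
    rw [norm_smul, norm_mul, Real.norm_of_nonneg (by positivity)]
    calc (‖w‖ ^ 2 + ε ^ 2) ^ (-(n / 2)) * (‖(D w : ℂ) + Complex.I * (D (J w) : ℂ)‖ * ‖c‖)
        ≤ (‖w‖ ^ 2 + ε ^ 2) ^ (-(n / 2)) * (2 * (‖D‖ * ‖w‖) * ‖c‖) := by gcongr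
      _ = 2 * (‖c‖ * ‖D‖ * (‖w‖ * (‖w‖ ^ 2 + ε ^ 2) ^ (-(n / 2)))) := by ring
      _ ≤ 2 * (‖c‖ * ‖D‖ * ‖w‖ ^ (1 - n)) := by gcongr
  rw [← ofReal_norm, ← ofReal_norm, ← ofReal_norm,
    ← ENNReal.ofReal_mul (norm_nonneg _), ← ENNReal.ofReal_mul (by positivity),
    show (2 : ℝ≥0∞) = ENNReal.ofReal 2 by simp, ← ENNReal.ofReal_mul (by norm_num)]
  exact ENNReal.ofReal_le_ofReal h5

variable [FiniteDimensional ℝ E] [MeasurableSpace E] [BorelSpace E] (μ : Measure E)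
  [μ.IsAddHaarMeasure]

lemma enorm_integral_le_of_fderiv_identity {J : E →L[ℝ] E} (hJ : ∀ v, inner ℝ v (J v) = 0)
    {G A B : E → ℂ} {K : NNReal} (hG : LipschitzWith K G) (hGs : HasCompactSupport G)
    (hA : Integrable A μ) {n : ℝ} (hn : n = Module.finrank ℝ E) (x : E)
    (h : ∀ᵐ z ∂μ, A z = n • G z + fderiv ℝ G z ((ContinuousLinearMap.id ℝ E) (z - x)) +
      Complex.I * fderiv ℝ G z (J (z - x)) - B z) :
    ‖∫ z, A z ∂μ‖ₑ ≤ ∫⁻ z, ‖B z‖ₑ ∂μ := by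
  have hGint : Integrable G μ := hG.continuous.integrable_of_hasCompactSupport hGs
  have h1 := integral_fderiv_apply_linear (μ := μ) hG hGs x (ContinuousLinearMap.id ℝ E)
    (stdOrthonormalBasis ℝ E)
  have h2 := integral_fderiv_apply_linear (μ := μ) hG hGs x J (stdOrthonormalBasis ℝ E)
  have htr : ∑ i, inner ℝ (stdOrthonormalBasis ℝ E i)
      ((ContinuousLinearMap.id ℝ E) (stdOrthonormalBasis ℝ E i)) = n := by
    simp [hn]
  rw [htr] at h1
  simp only [hJ, Finset.sum_const_zero, zero_smul, neg_zero] at h2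
  have i1 := integrable_fderiv_apply (μ := μ) hG hGs
    (v := fun z => (ContinuousLinearMap.id ℝ E) (z - x)) (by fun_prop)
  have i2 := (integrable_fderiv_apply (μ := μ) hG hGs
    (v := fun z => J (z - x)) (by fun_prop)).const_mul Complex.I
  have i0 : Integrable (fun z => n • G z) μ := hGint.fun_smul n
  have i01 : Integrable
    (fun z => n • G z + fderiv ℝ G z ((ContinuousLinearMap.id ℝ E) (z - x))) μ := i0.add i1
  have e3 : ∫ z, (n • G z + fderiv ℝ G z ((ContinuousLinearMap.id ℝ E) (z - x)) +
      Complex.I * fderiv ℝ G z (J (z - x))) ∂μ = 0 := by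
    rw [integral_add i01 i2, integral_add i0 i1,
      integral_smul, h1, integral_const_mul, h2]
    simp
  have hB : ∫ z, A z ∂μ = -∫ z, B z ∂μ := by
    rw [eq_neg_iff_add_eq_zero, ← e3, ← sub_neg_eq_add, ← integral_neg, ← integral_sub hA]
    · refine integral_congr_ae ?_
      filter_upwards [h] with z hz
      rw [hz]; ring
    · refine (hA.sub (i01.add i2)).congr ?_
      filter_upwards [h] with z hz
      simp only [Pi.sub_apply, Pi.add_apply]
      rw [hz]; ring
  rw [hB, enorm_neg]
  exact enorm_integral_le_lintegral_enorm _

/-- The regularized Cauchy–Pompeiu estimate. -/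
lemma enorm_integral_kernel_le {J : E →L[ℝ] E} (hJ : ∀ v, inner ℝ v (J v) = 0)
    (hJn : ∀ v, ‖J v‖ ≤ ‖v‖) {χ : E → ℝ} {K : NNReal} (hχ : LipschitzWith K χ)
    (hsupp : HasCompactSupport χ) {f : E → ℂ} (hfL : ∀ z ∈ tsupport χ, LipschitzNear f z)
    (hfd : ∀ z ∈ tsupport χ, DifferentiableAt ℝ f z)
    (hCR : ∀ z ∈ tsupport χ, ∀ v, fderiv ℝ f z (J v) = Complex.I * fderiv ℝ f z v)
    {n : ℝ} (hn : n = Module.finrank ℝ E) (hn0 : 0 < n) (x : E) {ε : ℝ} (hε : 0 < ε) :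
    ‖∫ z, (n * ε ^ 2 * (‖z - x‖ ^ 2 + ε ^ 2) ^ (-(n / 2) - 1)) • (χ z • f z) ∂μ‖ₑ ≤
      2 * ∫⁻ z, ‖f z‖ₑ * ‖fderiv ℝ χ z‖ₑ * ENNReal.ofReal (‖z - x‖ ^ (1 - n)) ∂μ := by
  have hSs : HasCompactSupport (fun z => χ z • f z) :=
    hsupp.mono fun z hz h => hz (by simp [h])
  obtain ⟨KS, hSL⟩ := exists_lipschitzWith_of_lipschitzNear
    (lipschitzNear_smul_of_tsupport hχ hfL) hSs
  have hGs : HasCompactSupport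
      (fun z => (‖z - x‖ ^ 2 + ε ^ 2) ^ (-(n / 2)) • (χ z • f z)) :=
    hSs.mono fun z hz h => hz (by simp only [h, smul_zero])
  obtain ⟨KG, hGL⟩ := exists_lipschitzWith_of_lipschitzNear
    (fun z => ((contDiff_norm_sq_add_rpow hε (-(n / 2)) x).lipschitzNear z).smul
      (hSL.lipschitzNear z)) hGs
  have hint1 : Integrable
      (fun z => (n * ε ^ 2 * (‖z - x‖ ^ 2 + ε ^ 2) ^ (-(n / 2) - 1)) • (χ z • f z)) μ := by
    refine Continuous.integrable_of_hasCompactSupport ?_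
      (hSs.mono fun z hz h => hz (by simp only [h, smul_zero]))
    exact (continuous_const.mul (contDiff_norm_sq_add_rpow hε _ x).continuous).smul hSL.continuous
  refine (enorm_integral_le_of_fderiv_identity μ hJ hGL hGs hint1 hn x (B := fun z =>
    (‖z - x‖ ^ 2 + ε ^ 2) ^ (-(n / 2)) •
      (((fderiv ℝ χ z (z - x) : ℂ) + Complex.I * (fderiv ℝ χ z (J (z - x)) : ℂ)) * f z)) ?_).trans
      ?_
  · filter_upwards [hχ.ae_differentiableAt (μ := μ)] with z hz
    by_cases hzs : z ∈ tsupport χ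
    · exact cauchyRiemann_identity hJ n x hε hz (hfd z hzs) (hCR z hzs)
    · have h0 : χ z = 0 := image_eq_zero_of_notMem_tsupport hzs
      have hsub : tsupport (fun z => (‖z - x‖ ^ 2 + ε ^ 2) ^ (-(n / 2)) • (χ z • f z)) ⊆
          tsupport χ :=
        closure_mono fun y hy h => hy (by simp only [h, zero_smul, smul_zero])
      have hG0 := fderiv_eq_zero_of_notMem_tsupport (fun h => hzs (hsub h))
      rw [hG0, fderiv_eq_zero_of_notMem_tsupport hzs]
      simp [h0]
  · rw [← lintegral_const_mul' _ _ (by simp)]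
    exact lintegral_mono fun z => enorm_smul_cauchyRiemann_le hJn _ _ hn0 _ _

end CauchyRiemann

section ApproximateIdentity

open Metric Set Filter Topology

variable {E : Type*} [NormedAddCommGroup E] [InnerProductSpace ℝ E] [FiniteDimensional ℝ E]
  [MeasurableSpace E] [BorelSpace E] (μ : Measure E) [μ.IsAddHaarMeasure]

lemma integral_kernel_eq {n : ℝ} (hn : n = Module.finrank ℝ E) (x : E) {ε : ℝ} (hε : 0 < ε)
    (h : E → ℂ) :
    ∫ z, (n * ε ^ 2 * (‖z - x‖ ^ 2 + ε ^ 2) ^ (-(n / 2) - 1)) • h z ∂μ =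
      ∫ y, (n * (1 + ‖y‖ ^ 2) ^ (-(n + 2) / 2)) • h (x + ε • y) ∂μ := by
  rw [← integral_add_left_eq_self _ x]
  have h1 := Measure.integral_comp_smul μ
    (fun y => (n * ε ^ 2 * (‖x + y - x‖ ^ 2 + ε ^ 2) ^ (-(n / 2) - 1)) • h (x + y)) ε
  rw [eq_comm, abs_of_pos (by positivity), inv_smul_eq_iff₀ (by positivity)] at h1
  rw [h1, ← integral_smul]
  refine integral_congr_ae (.of_forall fun y => ?_)
  simp only [add_sub_cancel_left, smul_smul]
  congr 1
  have e1 : ‖ε • y‖ ^ 2 + ε ^ 2 = ε ^ 2 * (1 + ‖y‖ ^ 2) := by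
    rw [norm_smul, Real.norm_of_nonneg hε.le]; ring
  have e2 : (ε ^ 2) ^ (-(n / 2) - 1) = ε ^ (-n) * ε ^ (-2 : ℝ) := by
    rw [← Real.rpow_natCast ε 2, ← Real.rpow_mul hε.le, ← Real.rpow_add hε]
    congr 1; push_cast; ring
  rw [e1, Real.mul_rpow (by positivity) (by positivity), e2,
    ← Real.rpow_natCast ε (Module.finrank ℝ E), ← hn,
    Real.rpow_neg hε.le, Real.rpow_neg hε.le, show -(n + 2) / 2 = -(n / 2) - 1 by ring]
  have : ε ^ n ≠ 0 := by positivity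
  norm_num
  field_simp

lemma exists_pos_mul_enorm_le_of_integral_kernel_le {n : ℝ} (hn : n = Module.finrank ℝ E)
    (hn0 : 0 < n) :
    ∃ c : ℝ, 0 < c ∧ ∀ (h : E → ℂ) (x : E) (B : ℝ≥0∞), Continuous h → HasCompactSupport h →
      (∀ ε : ℝ, 0 < ε →
        ‖∫ z, (n * ε ^ 2 * (‖z - x‖ ^ 2 + ε ^ 2) ^ (-(n / 2) - 1)) • h z ∂μ‖ₑ ≤ B) →
      ENNReal.ofReal c * ‖h x‖ₑ ≤ B := by
  have hk : Integrable (fun y : E => n * (1 + ‖y‖ ^ 2) ^ (-(n + 2) / 2)) μ :=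
    (integrable_rpow_neg_one_add_norm_sq (μ := μ) (by linarith)).const_mul n
  have hkpos : ∀ y : E, 0 < n * (1 + ‖y‖ ^ 2) ^ (-(n + 2) / 2) := fun y => by positivity
  refine ⟨∫ y, n * (1 + ‖y‖ ^ 2) ^ (-(n + 2) / 2) ∂μ, ?_, ?_⟩
  · rw [integral_pos_iff_support_of_nonneg (fun y => (hkpos y).le) hk]
    have : Function.support (fun y : E => n * (1 + ‖y‖ ^ 2) ^ (-(n + 2) / 2)) = univ :=
      eq_univ_of_forall fun y => (hkpos y).ne'
    rw [this]
    exact Measure.measure_univ_pos.2 (NeZero.ne μ)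
  · intro h x B hc hs hB
    obtain ⟨M, hM⟩ := hs.exists_bound_of_continuous hc
    have hlim : Tendsto (fun j : ℕ => ∫ y, (n * (1 + ‖y‖ ^ 2) ^ (-(n + 2) / 2)) •
        h (x + (1 / ((j : ℝ) + 1)) • y) ∂μ) atTop
        (𝓝 (∫ y, (n * (1 + ‖y‖ ^ 2) ^ (-(n + 2) / 2)) • h x ∂μ)) := by
      refine tendsto_integral_of_dominated_convergence
        (fun y => (n * (1 + ‖y‖ ^ 2) ^ (-(n + 2) / 2)) * M) (fun j => ?_) (hk.mul_const M)
        (fun j => .of_forall fun y => ?_) (.of_forall fun y => ?_)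
      · exact hk.aestronglyMeasurable.smul (by fun_prop)
      · rw [norm_smul, Real.norm_of_nonneg (hkpos y).le]
        exact mul_le_mul_of_nonneg_left (hM _) (hkpos y).le
      · refine Tendsto.const_smul ?_ _
        have : Tendsto (fun j : ℕ => x + (1 / ((j : ℝ) + 1)) • y) atTop (𝓝 (x + (0 : ℝ) • y)) :=
          (tendsto_one_div_add_atTop_nhds_zero_nat.smul_const y).const_add x
        rw [zero_smul, add_zero] at this
        exact (hc.tendsto x).comp this
    rw [integral_smul_const] at hlim
    have h2 := le_of_tendsto hlim.enorm (.of_forall fun j => by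
      rw [← integral_kernel_eq μ hn x Nat.one_div_pos_of_nat]
      exact hB _ Nat.one_div_pos_of_nat)
    rwa [enorm_smul, Real.enorm_of_nonneg (integral_nonneg fun y => (hkpos y).le)] at h2

end ApproximateIdentity

section Holomorphic

open Metric Set Filter Topology

lemma lipschitzNear_of_differentiableOn {E : Type*} [NormedAddCommGroup E] [NormedSpace ℂ E]
    {f : E → ℂ} {V : Set E} (hf : DifferentiableOn ℂ f V) (hV : IsOpen V) {z : E} (hz : z ∈ V) :
    LipschitzNear f z := by
  have hcont : ContinuousAt f z := (hf.differentiableAt (hV.mem_nhds hz)).continuousAt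
  obtain ⟨r, hr, hrV⟩ : ∃ r > 0, ball z (3 * r) ⊆ V ∩ f ⁻¹' ball (f z) 1 := by
    obtain ⟨s, hs, h⟩ := Metric.mem_nhds_iff.1
      (inter_mem (hV.mem_nhds hz) (hcont (ball_mem_nhds (f z) one_pos)))
    exact ⟨s / 3, by positivity, by rwa [mul_div_cancel₀ _ (three_ne_zero' ℝ)]⟩
  refine ⟨(2 / (2 * r)).toNNReal, ball z r, ball_mem_nhds z hr,
    LipschitzOnWith.of_dist_le_mul fun b hb a ha => ?_⟩
  rw [Real.coe_toNNReal _ (by positivity)]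
  rw [mem_ball] at ha hb
  have hsub : ball a (2 * r) ⊆ ball z (3 * r) := ball_subset_ball' (by linarith)
  refine Complex.dist_le_div_mul_dist_of_mapsTo_ball
    (hf.mono fun y hy => (hrV (hsub hy)).1) (fun y hy => ?_)
    (mem_ball.2 ((dist_triangle_right b a z).trans_lt (by linarith)))
  have h1 : dist (f y) (f z) < 1 := (hrV (hsub hy)).2
  have h2 : dist (f a) (f z) < 1 := (hrV (mem_ball.2 (by linarith))).2
  exact mem_closedBall.2 ((dist_triangle_right (f y) (f a) (f z)).trans (by linarith))

lemma finrank_real_euclideanSpace_complex (d : ℕ) :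
    (Module.finrank ℝ (EuclideanSpace ℂ (Fin d)) : ℝ) = 2 * (d : ℝ) := by
  rw [← Module.finrank_mul_finrank ℝ ℂ, Complex.finrank_real_complex, finrank_euclideanSpace_fin]
  push_cast
  ring

/-- A holomorphic function is controlled at a point by a singular integral against the gradient
of a cutoff function. -/
lemma exists_pos_mul_enorm_le_lintegral (d : ℕ) (hd : 1 ≤ d) :
    ∃ c : ℝ, 0 < c ∧ ∀ (f : EuclideanSpace ℂ (Fin d) → ℂ) (V : Set (EuclideanSpace ℂ (Fin d)))
      (χ : EuclideanSpace ℂ (Fin d) → ℝ) (K : NNReal) (x : EuclideanSpace ℂ (Fin d)),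
      IsOpen V → DifferentiableOn ℂ f V → LipschitzWith K χ → HasCompactSupport χ →
      tsupport χ ⊆ V → χ x = 1 →
      ENNReal.ofReal c * ‖f x‖ₑ ≤
        ∫⁻ z, ‖f z‖ₑ * ‖fderiv ℝ χ z‖ₑ * ENNReal.ofReal (‖z - x‖ ^ (1 - 2 * (d : ℝ))) := by
  have hfin : (2 * (d : ℝ)) = Module.finrank ℝ (EuclideanSpace ℂ (Fin d)) :=
    (finrank_real_euclideanSpace_complex d).symm
  have hd0 : 0 < 2 * (d : ℝ) := by positivity
  obtain ⟨c, hc, h⟩ := exists_pos_mul_enorm_le_of_integral_kernel_le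
    (volume : Measure (EuclideanSpace ℂ (Fin d))) hfin hd0
  refine ⟨c / 2, by positivity, fun f V χ K x hV hf hχ hs hsV hx => ?_⟩
  let J : EuclideanSpace ℂ (Fin d) →L[ℝ] EuclideanSpace ℂ (Fin d) :=
    (Complex.I • ContinuousLinearMap.id ℂ (EuclideanSpace ℂ (Fin d))).restrictScalars ℝ
  have hJv : ∀ v, J v = Complex.I • v := fun v => rfl
  have hJ : ∀ v, inner ℝ v (J v) = 0 := fun v => by
    rw [hJv]
    simp only [PiLp.inner_apply, PiLp.smul_apply, Complex.inner]
    refine Finset.sum_eq_zero fun i _ => ?_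
    simp
    ring
  have hJn : ∀ v, ‖J v‖ ≤ ‖v‖ := fun v => by
    rw [hJv, norm_smul, Complex.norm_I, one_mul]
  have hfd : ∀ z ∈ tsupport χ, DifferentiableAt ℂ f z := fun z hz =>
    hf.differentiableAt (hV.mem_nhds (hsV hz))
  have hL : ∀ z ∈ tsupport χ, LipschitzNear f z := fun z hz =>
    lipschitzNear_of_differentiableOn hf hV (hsV hz)
  have hSs : HasCompactSupport (fun z => χ z • f z) :=
    hs.mono fun z hz h => hz (by simp [h])
  obtain ⟨KS, hSL⟩ := exists_lipschitzWith_of_lipschitzNear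
    (lipschitzNear_smul_of_tsupport hχ hL) hSs
  have h2 := h _ x _ hSL.continuous hSs fun ε hε =>
    enorm_integral_kernel_le volume hJ hJn hχ hs hL
      (fun z hz => (hfd z hz).restrictScalars ℝ)
      (fun z hz v => by
        rw [(hfd z hz).fderiv_restrictScalars ℝ]
        simp [hJv]) hfin hd0 x hε
  rw [hx, one_smul] at h2
  rw [ENNReal.ofReal_div_of_pos two_pos, ENNReal.ofReal_ofNat, mul_comm, ← mul_div_assoc, mul_comm]
  exact ENNReal.div_le_of_le_mul' h2

end Holomorphic

section WeightedEnergy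

open Metric Set Filter Topology

variable {E : Type*} [NormedAddCommGroup E] [NormedSpace ℝ E] [MeasurableSpace E]

/-- The `L^q` energy `∫ (|∇g| |z - x|^a)^q` of a function, with a power weight centred at `x`. -/
noncomputable def weightedEnergy (μ : Measure E) (x : E) (a q : ℝ) (g : E → ℝ) : ℝ≥0∞ :=
  ∫⁻ z, (‖fderiv ℝ g z‖ₑ * ENNReal.ofReal (‖z - x‖ ^ a)) ^ q ∂μ

lemma fderiv_eq_of_le_of_eq {E : Type*} [NormedAddCommGroup E] [NormedSpace ℝ E] {g h : E → ℝ}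
    {z : E} (hg : DifferentiableAt ℝ g z) (hh : DifferentiableAt ℝ h z) (hle : ∀ y, g y ≤ h y)
    (heq : g z = h z) : fderiv ℝ g z = fderiv ℝ h z := by
  have hmin : IsLocalMin (fun y => h y - g y) z :=
    .of_forall fun y => by simpa [heq] using hle y
  have h0 := hmin.fderiv_eq_zero
  rw [fderiv_fun_sub hh hg] at h0
  exact (sub_eq_zero.1 h0).symm

lemma fderiv_eq_zero_of_nonneg {E : Type*} [NormedAddCommGroup E] [NormedSpace ℝ E] {g : E → ℝ}
    {z : E} (h : ∀ y, 0 ≤ g y) (hz : g z = 0) : fderiv ℝ g z = 0 :=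
  IsLocalMin.fderiv_eq_zero (.of_forall fun y => hz ▸ h y)

variable {μ : Measure E} {x : E} {a q : ℝ} {g h : E → ℝ} {K L : NNReal}

lemma weightedEnergy_const (hq : 0 < q) (c : ℝ) : weightedEnergy μ x a q (fun _ => c) = 0 := by
  have h0 : ‖(0 : E →L[ℝ] ℝ)‖ₑ = 0 := by rw [← ofReal_norm, norm_zero, ENNReal.ofReal_zero]
  simp [weightedEnergy, h0, hq]

lemma weightedEnergy_const_sub (c : ℝ) :
    weightedEnergy μ x a q (fun y => c - g y) = weightedEnergy μ x a q g := by
  simp [weightedEnergy, fderiv_const_sub]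

lemma measurable_weighted_fderiv [BorelSpace E] (x : E) (a : ℝ) (g : E → ℝ) :
    Measurable fun z => ‖fderiv ℝ g z‖ₑ * ENNReal.ofReal (‖z - x‖ ^ a) :=
  (measurable_fderiv ℝ g).enorm.mul
    (((measurable_id.sub_const x).norm.pow_const a).ennreal_ofReal)

variable [FiniteDimensional ℝ E] [BorelSpace E] [μ.IsAddHaarMeasure]

lemma ae_fderiv_max (hg : LipschitzWith K g) (hh : LipschitzWith L h) :
    ∀ᵐ z ∂μ, fderiv ℝ (fun y => max (g y) (h y)) z = fderiv ℝ g z ∨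
      fderiv ℝ (fun y => max (g y) (h y)) z = fderiv ℝ h z := by
  filter_upwards [hg.ae_differentiableAt (μ := μ), hh.ae_differentiableAt (μ := μ),
    (hg.max hh).ae_differentiableAt (μ := μ)] with z h1 h2 h3
  rcases le_total (g z) (h z) with hz | hz
  · exact Or.inr (fderiv_eq_of_le_of_eq h2 h3 (fun y => le_max_right _ _) (by simp [hz])).symm
  · exact Or.inl (fderiv_eq_of_le_of_eq h1 h3 (fun y => le_max_left _ _) (by simp [hz])).symm

lemma weightedEnergy_max_le (hg : LipschitzWith K g) (hh : LipschitzWith L h) :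
    weightedEnergy μ x a q (fun y => max (g y) (h y)) ≤
      weightedEnergy μ x a q g + weightedEnergy μ x a q h := by
  unfold weightedEnergy
  rw [← lintegral_add_left ((measurable_weighted_fderiv x a g).pow_const q)]
  refine lintegral_mono_ae ?_
  filter_upwards [ae_fderiv_max hg hh] with z hz
  rcases hz with hz | hz <;> rw [hz]
  · exact le_self_add
  · exact le_add_self

lemma exists_finset_max {ι : Type*} (s : Finset ι) (g₀ : E → ℝ) (g : ι → E → ℝ)
    (h₀ : ∃ K, LipschitzWith K g₀) (hg : ∀ i ∈ s, ∃ K, LipschitzWith K (g i)) :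
    ∃ h : E → ℝ, (∃ K, LipschitzWith K h) ∧ (∀ z, g₀ z ≤ h z) ∧ (∀ i ∈ s, ∀ z, g i z ≤ h z) ∧
      (∀ z, h z = g₀ z ∨ ∃ i ∈ s, h z = g i z) ∧
      weightedEnergy μ x a q h ≤
        weightedEnergy μ x a q g₀ + ∑ i ∈ s, weightedEnergy μ x a q (g i) := by
  classical
  induction s using Finset.induction_on with
  | empty => exact ⟨g₀, h₀, fun z => le_rfl, by simp, fun z => Or.inl rfl, by simp⟩
  | insert i s his ih =>
    obtain ⟨h, ⟨K, hK⟩, hh0, hhg, hor, hW⟩ := ih fun j hj => hg j (Finset.mem_insert_of_mem hj)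
    obtain ⟨L, hL⟩ := hg i (Finset.mem_insert_self i s)
    refine ⟨fun z => max (h z) (g i z), ⟨_, hK.max hL⟩, fun z => le_max_of_le_left (hh0 z), ?_, ?_,
      ?_⟩
    · intro j hj z
      rcases Finset.mem_insert.1 hj with rfl | hj
      · exact le_max_right _ _
      · exact le_max_of_le_left (hhg j hj z)
    · intro z
      rcases max_choice (h z) (g i z) with hz | hz
      · rcases hor z with h1 | ⟨j, hj, h1⟩
        · exact Or.inl (hz.trans h1)
        · exact Or.inr ⟨j, Finset.mem_insert_of_mem hj, hz.trans h1⟩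
      · exact Or.inr ⟨i, Finset.mem_insert_self i s, hz⟩
    · rw [Finset.sum_insert his, add_comm (weightedEnergy μ x a q (g i)), ← add_assoc]
      exact (weightedEnergy_max_le hK hL).trans (by gcongr)

end WeightedEnergy

section InnerCutoff

open Metric Set Filter Topology

variable {E : Type*} [NormedAddCommGroup E]

/-- A Lipschitz cutoff vanishing on the ball of radius `δ` and equal to `1` off the ball of
radius `2 * δ`. -/
noncomputable def innerCutoff (x : E) (δ : ℝ) (z : E) : ℝ := max 0 (min 1 (δ⁻¹ * ‖z - x‖ - 1))

variable {x z : E} {δ : ℝ}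

lemma innerCutoff_nonneg : 0 ≤ innerCutoff x δ z := le_max_left _ _

lemma innerCutoff_le_one : innerCutoff x δ z ≤ 1 := max_le zero_le_one (min_le_left _ _)

lemma innerCutoff_eq_zero (hδ : 0 < δ) (h : ‖z - x‖ ≤ δ) : innerCutoff x δ z = 0 := by
  have : δ⁻¹ * ‖z - x‖ ≤ 1 := by rwa [inv_mul_le_iff₀ hδ, mul_one]
  exact max_eq_left ((min_le_right _ _).trans (by linarith))

lemma innerCutoff_eq_one (hδ : 0 < δ) (h : 2 * δ ≤ ‖z - x‖) : innerCutoff x δ z = 1 := by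
  have : 2 ≤ δ⁻¹ * ‖z - x‖ := by rw [le_inv_mul_iff₀ hδ]; linarith
  rw [innerCutoff, min_eq_left (by linarith), max_eq_right zero_le_one]

lemma lipschitzWith_innerCutoff (x : E) (hδ : 0 < δ) :
    LipschitzWith (δ⁻¹).toNNReal (innerCutoff x δ) := by
  refine (LipschitzWith.const_min (LipschitzWith.of_dist_le_mul fun y z => ?_) 1).const_max 0
  rw [Real.coe_toNNReal _ (by positivity), Real.dist_eq, sub_sub_sub_cancel_right, ← mul_sub,
    abs_mul, abs_of_pos (by positivity : 0 < δ⁻¹), dist_eq_norm]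
  gcongr
  simpa using abs_norm_sub_norm_le (y - x) (z - x)

variable [NormedSpace ℝ E]

lemma fderiv_innerCutoff_eq_zero (hδ : 0 < δ) (h : ‖z - x‖ ≤ δ ∨ 2 * δ ≤ ‖z - x‖) :
    fderiv ℝ (innerCutoff x δ) z = 0 := by
  rcases h with h | h
  · exact fderiv_eq_zero_of_nonneg (fun _ => innerCutoff_nonneg) (innerCutoff_eq_zero hδ h)
  · exact IsLocalMax.fderiv_eq_zero
      (.of_forall fun y => (innerCutoff_eq_one hδ h).symm ▸ innerCutoff_le_one)

lemma norm_fderiv_innerCutoff_le (hδ : 0 < δ) : ‖fderiv ℝ (innerCutoff x δ) z‖ ≤ δ⁻¹ := by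
  simpa [hδ.le] using norm_fderiv_le_of_lipschitz ℝ (lipschitzWith_innerCutoff x hδ) (x₀ := z)

lemma rpow_add_le {q s t : ℝ} (hq : 0 ≤ q) (hs : 0 ≤ s) (ht : 0 ≤ t) :
    (s + t) ^ q ≤ 2 ^ q * (s ^ q + t ^ q) := by
  rcases le_total s t with h | h
  · calc (s + t) ^ q ≤ (2 * t) ^ q := by gcongr; linarith
      _ = 2 ^ q * t ^ q := Real.mul_rpow (by norm_num) ht
      _ ≤ _ := by
        gcongr
        linarith [Real.rpow_nonneg hs q]
  · calc (s + t) ^ q ≤ (2 * s) ^ q := by gcongr; linarith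
      _ = 2 ^ q * s ^ q := Real.mul_rpow (by norm_num) hs
      _ ≤ _ := by
        gcongr
        linarith [Real.rpow_nonneg ht q]

/-- Pointwise bound for the weighted gradient of a function multiplied by the cutoff. -/
lemma weighted_fderiv_innerCutoff_mul_le {a q : ℝ} (ha : a ≤ 0) (hq : 0 < q) (hδ : 0 < δ)
    {u : E → ℝ} (hu : DifferentiableAt ℝ u z) (hψ : DifferentiableAt ℝ (innerCutoff x δ) z) :
    (‖fderiv ℝ (fun z => innerCutoff x δ z * u z) z‖ * ‖z - x‖ ^ a) ^ q ≤
      (δ ^ a) ^ q * 2 ^ q * (‖fderiv ℝ u z‖ ^ q +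
        5 ^ (q / 2) * ((‖z - x‖ ^ 2 + δ ^ 2) ^ (-(q / 2)) * |u z| ^ q)) := by
  have hD : fderiv ℝ (fun z => innerCutoff x δ z * u z) z =
      innerCutoff x δ z • fderiv ℝ u z + u z • fderiv ℝ (innerCutoff x δ) z :=
    fderiv_fun_mul hψ hu
  rcases le_or_gt ‖z - x‖ δ with h | h
  · rw [hD, innerCutoff_eq_zero hδ h, fderiv_innerCutoff_eq_zero hδ (Or.inl h)]
    simp only [zero_smul, smul_zero, add_zero, norm_zero, zero_mul, Real.zero_rpow hq.ne']
    positivity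
  have hw : ‖z - x‖ ^ a ≤ δ ^ a := Real.rpow_le_rpow_of_nonpos hδ h.le ha
  have h1 : ‖fderiv ℝ (fun z => innerCutoff x δ z * u z) z‖ ≤
      ‖fderiv ℝ u z‖ + |u z| * ‖fderiv ℝ (innerCutoff x δ) z‖ := by
    rw [hD]
    refine (norm_add_le _ _).trans ?_
    rw [norm_smul, norm_smul, Real.norm_of_nonneg innerCutoff_nonneg, Real.norm_eq_abs]
    gcongr
    exact mul_le_of_le_one_left (norm_nonneg _) innerCutoff_le_one
  have h2 : (|u z| * ‖fderiv ℝ (innerCutoff x δ) z‖) ^ q ≤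
      5 ^ (q / 2) * ((‖z - x‖ ^ 2 + δ ^ 2) ^ (-(q / 2)) * |u z| ^ q) := by
    rcases le_or_gt (2 * δ) ‖z - x‖ with h3 | h3
    · rw [fderiv_innerCutoff_eq_zero hδ (Or.inr h3), norm_zero, mul_zero, Real.zero_rpow hq.ne']
      positivity
    · have h4 : (5 * δ ^ 2) ^ (-(q / 2)) ≤ (‖z - x‖ ^ 2 + δ ^ 2) ^ (-(q / 2)) :=
        Real.rpow_le_rpow_of_nonpos (by positivity) (by nlinarith) (by linarith)
      have h5 : (δ⁻¹) ^ q = 5 ^ (q / 2) * (5 * δ ^ 2) ^ (-(q / 2)) := by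
        rw [Real.mul_rpow (by norm_num) (by positivity), ← mul_assoc, ← Real.rpow_add (by norm_num),
          ← Real.rpow_natCast δ 2, ← Real.rpow_mul hδ.le, Real.inv_rpow hδ.le,
          ← Real.rpow_neg hδ.le]
        norm_num
        congr 1
        ring
      calc (|u z| * ‖fderiv ℝ (innerCutoff x δ) z‖) ^ q ≤ (|u z| * δ⁻¹) ^ q := by
            gcongr
            exact norm_fderiv_innerCutoff_le hδ
        _ = 5 ^ (q / 2) * ((5 * δ ^ 2) ^ (-(q / 2)) * |u z| ^ q) := by
            rw [Real.mul_rpow (abs_nonneg _) (by positivity), h5]; ring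
        _ ≤ _ := by gcongr
  calc (‖fderiv ℝ (fun z => innerCutoff x δ z * u z) z‖ * ‖z - x‖ ^ a) ^ q
      ≤ ((‖fderiv ℝ u z‖ + |u z| * ‖fderiv ℝ (innerCutoff x δ) z‖) * δ ^ a) ^ q := by gcongr
    _ = (δ ^ a) ^ q * (‖fderiv ℝ u z‖ + |u z| * ‖fderiv ℝ (innerCutoff x δ) z‖) ^ q := by
        rw [Real.mul_rpow (by positivity) (by positivity), mul_comm]
    _ ≤ (δ ^ a) ^ q * (2 ^ q * (‖fderiv ℝ u z‖ ^ q +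
        (|u z| * ‖fderiv ℝ (innerCutoff x δ) z‖) ^ q)) := by
        gcongr
        exact rpow_add_le hq.le (norm_nonneg _) (by positivity)
    _ ≤ _ := by
        rw [mul_assoc]
        gcongr

lemma enorm_mul_ofReal_rpow {q : ℝ} (hq : 0 ≤ q) {F : Type*} [SeminormedAddCommGroup F]
    (v : F) {w : ℝ} (hw : 0 ≤ w) :
    (‖v‖ₑ * ENNReal.ofReal w) ^ q = ENNReal.ofReal ((‖v‖ * w) ^ q) := by
  rw [← ofReal_norm, ← ENNReal.ofReal_mul (norm_nonneg _),
    ENNReal.ofReal_rpow_of_nonneg (by positivity) hq]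

end InnerCutoff

section CutoffEnergy

open Metric Set Filter Topology

variable {E : Type*} [NormedAddCommGroup E] [InnerProductSpace ℝ E] [FiniteDimensional ℝ E]

lemma exists_lipschitzWith_innerCutoff_mul {x : E} {δ : ℝ} (hδ : 0 < δ) {u : E → ℝ} {K : NNReal}
    (hu : LipschitzWith K u) (hs : HasCompactSupport u) :
    ∃ L, LipschitzWith L (fun z => innerCutoff x δ z * u z) :=
  exists_lipschitzWith_of_lipschitzNear
    (fun z => ((lipschitzWith_innerCutoff x hδ).lipschitzNear z).smul (hu.lipschitzNear z))
    (hs.mono fun z hz h => hz (by simp [h]))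

variable [MeasurableSpace E] [BorelSpace E] (μ : Measure E) [μ.IsAddHaarMeasure]

lemma exists_weightedEnergy_innerCutoff_mul_le {q : ℝ} (hq : 1 < q)
    (hqn : q < Module.finrank ℝ E) :
    ∃ C : ℝ, 0 ≤ C ∧ ∀ (u : E → ℝ) (K : NNReal), LipschitzWith K u → HasCompactSupport u →
      ∀ (x : E) (a δ : ℝ), a ≤ 0 → 0 < δ →
        weightedEnergy μ x a q (fun z => innerCutoff x δ z * u z) ≤
          ENNReal.ofReal (C * (δ ^ a) ^ q * ∫ z, ‖fderiv ℝ u z‖ ^ q ∂μ) := by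
  obtain ⟨C, hC, hH⟩ := exists_hardy_bound μ hq hqn
  have hq0 : 0 < q := by linarith
  refine ⟨2 ^ q * (1 + 5 ^ (q / 2) * C), by positivity, ?_⟩
  intro u K hu hs x a δ ha hδ
  obtain ⟨hi, hb⟩ := hH u K hu hs x δ hδ
  have hDi := integrable_norm_fderiv_rpow μ hu hs hq0
  have hFi : Integrable (fun z => (δ ^ a) ^ q * 2 ^ q * (‖fderiv ℝ u z‖ ^ q +
      5 ^ (q / 2) * ((‖z - x‖ ^ 2 + δ ^ 2) ^ (-(q / 2)) * |u z| ^ q))) μ :=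
    (hDi.add (hi.const_mul _)).const_mul _
  have hF0 : ∀ z, 0 ≤ (δ ^ a) ^ q * 2 ^ q * (‖fderiv ℝ u z‖ ^ q +
      5 ^ (q / 2) * ((‖z - x‖ ^ 2 + δ ^ 2) ^ (-(q / 2)) * |u z| ^ q)) := fun z => by positivity
  calc weightedEnergy μ x a q (fun z => innerCutoff x δ z * u z)
      ≤ ∫⁻ z, ENNReal.ofReal ((δ ^ a) ^ q * 2 ^ q * (‖fderiv ℝ u z‖ ^ q +
        5 ^ (q / 2) * ((‖z - x‖ ^ 2 + δ ^ 2) ^ (-(q / 2)) * |u z| ^ q))) ∂μ := by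
        refine lintegral_mono_ae ?_
        filter_upwards [hu.ae_differentiableAt (μ := μ),
          (lipschitzWith_innerCutoff x hδ).ae_differentiableAt (μ := μ)] with z hz1 hz2
        rw [enorm_mul_ofReal_rpow hq0.le _ (by positivity)]
        exact ENNReal.ofReal_le_ofReal (weighted_fderiv_innerCutoff_mul_le ha hq0 hδ hz1 hz2)
    _ = ENNReal.ofReal (∫ z, (δ ^ a) ^ q * 2 ^ q * (‖fderiv ℝ u z‖ ^ q +
        5 ^ (q / 2) * ((‖z - x‖ ^ 2 + δ ^ 2) ^ (-(q / 2)) * |u z| ^ q)) ∂μ) :=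
        (ofReal_integral_eq_lintegral_ofReal hFi (.of_forall hF0)).symm
    _ ≤ _ := by
        refine ENNReal.ofReal_le_ofReal ?_
        have hi' : Integrable (fun z => (‖z - x‖ ^ 2 + δ ^ 2) ^ (-(q / 2)) * |u z| ^ q) μ := hi
        have hb' : ∫ z, (‖z - x‖ ^ 2 + δ ^ 2) ^ (-(q / 2)) * |u z| ^ q ∂μ ≤
          C * ∫ z, ‖fderiv ℝ u z‖ ^ q ∂μ := hb
        rw [integral_const_mul, integral_add hDi (hi'.const_mul _), integral_const_mul]
        calc _ ≤ (δ ^ a) ^ q * 2 ^ q * ((∫ z, ‖fderiv ℝ u z‖ ^ q ∂μ) +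
            5 ^ (q / 2) * (C * ∫ z, ‖fderiv ℝ u z‖ ^ q ∂μ)) := by gcongr
          _ = _ := by ring

lemma weightedEnergy_innerCutoff_lt_top {q a δ : ℝ} (hq : 0 < q) (ha : a ≤ 0) (hδ : 0 < δ)
    (x : E) : weightedEnergy μ x a q (innerCutoff x δ) < ⊤ := by
  calc weightedEnergy μ x a q (innerCutoff x δ)
      ≤ ∫⁻ z, (closedBall x (2 * δ)).indicator
          (fun _ => ENNReal.ofReal ((δ⁻¹ * δ ^ a) ^ q)) z ∂μ := by
        refine lintegral_mono fun z => ?_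
        by_cases h : δ ≤ ‖z - x‖ ∧ ‖z - x‖ ≤ 2 * δ
        · rw [indicator_of_mem (by simpa [dist_eq_norm] using h.2),
            enorm_mul_ofReal_rpow hq.le _ (by positivity)]
          refine ENNReal.ofReal_le_ofReal ?_
          gcongr ?_ ^ _
          exact mul_le_mul (norm_fderiv_innerCutoff_le hδ)
            (Real.rpow_le_rpow_of_nonpos hδ h.1 ha) (by positivity) (by positivity)
        · rw [fderiv_innerCutoff_eq_zero hδ]
          · have h0 : ‖(0 : E →L[ℝ] ℝ)‖ₑ = 0 := by
              rw [← ofReal_norm, norm_zero, ENNReal.ofReal_zero]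
            simp [h0, hq]
          · by_contra! hc
            exact h ⟨hc.1.le, hc.2.le⟩
    _ < ⊤ := by
        rw [lintegral_indicator measurableSet_closedBall, setLIntegral_const]
        exact ENNReal.mul_lt_top (by simp) (isCompact_closedBall x _).measure_lt_top

lemma integral_norm_fderiv_dilation_le {q t : ℝ} (hqn : q ≤ Module.finrank ℝ E)
    (ht : 1 ≤ t) (u : E → ℝ) (x : E) :
    ∫ z, ‖fderiv ℝ (fun z => u (x + t • (z - x))) z‖ ^ q ∂μ ≤ ∫ z, ‖fderiv ℝ u z‖ ^ q ∂μ := by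
  have ht0 : 0 < t := by linarith
  have hD : ∀ z, ‖fderiv ℝ (fun z => u (x + t • (z - x))) z‖ ^ q =
      t ^ q * ‖fderiv ℝ u ((x - t • x) + t • z)‖ ^ q := by
    intro z
    have e : (fun z => u (x + t • (z - x))) = fun z => (fun y => u ((x - t • x) + y)) (t • z) := by
      ext z
      congr 1
      rw [smul_sub]; abel
    rw [e, fderiv_comp_smul (f := fun y => u ((x - t • x) + y)), fderiv_comp_add_left,
      norm_smul,
      Real.norm_of_nonneg ht0.le, Real.mul_rpow ht0.le (norm_nonneg _)]
  simp_rw [hD]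
  rw [integral_const_mul, Measure.integral_comp_smul μ
    (fun y => ‖fderiv ℝ u ((x - t • x) + y)‖ ^ q) t,
    integral_add_left_eq_self (fun y => ‖fderiv ℝ u y‖ ^ q), smul_eq_mul, ← mul_assoc]
  refine mul_le_of_le_one_left (by positivity) ?_
  rw [abs_of_pos (by positivity), ← div_eq_mul_inv, div_le_one (by positivity),
    ← Real.rpow_natCast]
  exact Real.rpow_le_rpow_of_exponent_le ht hqn

end CutoffEnergy

section CapacityCutoff

open Metric Set Filter Topology

/-- Every radius in the dyadic range lies in a slightly shrunken dyadic interval, possibly after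
dilation by `t ^ 2`. -/
lemma exists_dyadic_interval {t r : ℝ} (ht : 1 < t) (ht4 : t ^ 4 ≤ 2) (N : ℕ)
    (hr : r < 1 / 4) (hN : (1 / 2 : ℝ) ^ (N + 2) < r) :
    ∃ n ≤ N, (t * (1 / 2 : ℝ) ^ (n + 2) ≤ r ∧ r ≤ (1 / 2 : ℝ) ^ (n + 1) / t) ∨
      (t * (1 / 2 : ℝ) ^ (n + 2) ≤ t ^ 2 * r ∧ t ^ 2 * r ≤ (1 / 2 : ℝ) ^ (n + 1) / t) := by
  have hr0 : 0 < r := lt_trans (by positivity) hN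
  have ht0 : 0 < t := by linarith
  obtain ⟨m, hm1, hm2⟩ := exists_nat_pow_near_of_lt_one hr0 (by linarith : r ≤ 1)
    (by norm_num : (0 : ℝ) < 1 / 2) (by norm_num)
  have hm : 2 ≤ m := by
    by_contra! h
    have : (1 / 2 : ℝ) ^ 2 ≤ (1 / 2 : ℝ) ^ (m + 1) :=
      pow_le_pow_of_le_one (by norm_num) (by norm_num) (by lia)
    norm_num at this hr hm1
    linarith
  obtain ⟨n, rfl⟩ : ∃ n, m = n + 2 := ⟨m - 2, by lia⟩
  have hn : n + 1 ≤ N := by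
    have := (pow_lt_pow_iff_right_of_lt_one₀ (by norm_num : (0 : ℝ) < 1 / 2) (by norm_num)).1
      (hN.trans_le hm2)
    lia
  obtain ⟨s, hs⟩ : ∃ s : ℝ, s = (1 / 2 : ℝ) ^ (n + 3) := ⟨_, rfl⟩
  have hs0 : 0 < s := by rw [hs]; positivity
  have hs2 : (1 / 2 : ℝ) ^ (n + 2) = 2 * s := by rw [hs, pow_succ _ (n + 2)]; ring
  have hs4 : (1 / 2 : ℝ) ^ (n + 1) = 4 * s := by rw [hs, pow_succ, pow_succ]; ring
  have ht2 : 1 < t ^ 2 := by nlinarith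
  have ht3 : t ^ 3 ≤ 2 := by nlinarith [pow_pos ht0 3]
  have hm1' : s < r := by rw [hs]; exact hm1
  rw [hs2] at hm2
  rcases lt_or_ge r (t * s) with h1 | h1
  · refine ⟨n + 1, hn, Or.inr ⟨?_, ?_⟩⟩
    · rw [← hs]
      nlinarith
    · rw [show n + 1 + 1 = n + 2 by ring, hs2, le_div_iff₀ ht0]
      calc t ^ 2 * r * t ≤ t ^ 2 * (t * s) * t := by gcongr
        _ = t ^ 4 * s := by ring
        _ ≤ 2 * s := by gcongr
  rcases le_or_gt r (2 * s / t) with h2 | h2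
  · exact ⟨n + 1, hn, Or.inl ⟨by rw [← hs]; exact h1, by
      rw [show n + 1 + 1 = n + 2 by ring, hs2]; exact h2⟩⟩
  · refine ⟨n, by lia, Or.inr ⟨?_, ?_⟩⟩
    · rw [hs2]
      rw [div_lt_iff₀ ht0] at h2
      nlinarith
    · rw [hs4, le_div_iff₀ ht0]
      calc t ^ 2 * r * t ≤ t ^ 2 * (2 * s) * t := by gcongr
        _ = t ^ 3 * (2 * s) := by ring
        _ ≤ 2 * (2 * s) := by gcongr
        _ = 4 * s := by ring

variable {E : Type*} [NormedAddCommGroup E] [InnerProductSpace ℝ E] [FiniteDimensional ℝ E]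

lemma exists_lipschitzWith_hasCompactSupport_one_le {K : Set E} (hK : IsCompact K) :
    ∃ u : E → ℝ, (∃ L, LipschitzWith L u) ∧ HasCompactSupport u ∧ ∀ z ∈ K, 1 ≤ u z := by
  obtain ⟨R, hR⟩ := hK.isBounded.subset_closedBall 0
  refine ⟨fun z => max 0 (R + 1 - ‖z‖), ⟨1, LipschitzWith.const_max ?_ 0⟩, ?_, fun z hz => ?_⟩
  · refine LipschitzWith.of_dist_le_mul fun y z => ?_
    rw [Real.dist_eq, sub_sub_sub_cancel_left, NNReal.coe_one, one_mul, dist_comm, dist_eq_norm]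
    exact abs_norm_sub_norm_le z y
  · refine HasCompactSupport.intro (isCompact_closedBall 0 (R + 1)) fun z hz => ?_
    rw [mem_closedBall_zero_iff, not_le] at hz
    exact max_eq_left (by linarith)
  · have := mem_closedBall_zero_iff.1 (hR hz)
    exact le_max_of_le_right (by linarith)

variable [MeasureSpace E]

lemma exists_lipschitz_energy_le_sobolevCapacity {q : ℝ} {K A : Set E} (hK : IsCompact K)
    (hKA : K ⊆ A) {η : ℝ} (hη : 0 < η) :
    ∃ u : E → ℝ, (∃ L, LipschitzWith L u) ∧ HasCompactSupport u ∧ (∀ z ∈ K, 1 ≤ u z) ∧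
      ENNReal.ofReal (∫ z, ‖fderiv ℝ u z‖ ^ q) ≤ sobolevCapacity q A + ENNReal.ofReal η := by
  have hne : { t : ℝ | ∃ u : E → ℝ, (∃ L, LipschitzWith L u) ∧ HasCompactSupport u ∧
      (∀ z ∈ K, 1 ≤ u z) ∧ t = ∫ z, ‖fderiv ℝ u z‖ ^ q }.Nonempty := by
    obtain ⟨u, hu, hs, h1⟩ := exists_lipschitzWith_hasCompactSupport_one_le hK
    exact ⟨_, u, hu, hs, h1, rfl⟩
  obtain ⟨_, ⟨u, hu, hs, h1, rfl⟩, hlt⟩ := exists_lt_of_csInf_lt hne (lt_add_of_pos_right _ hη)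
  refine ⟨u, hu, hs, h1, ?_⟩
  calc ENNReal.ofReal (∫ z, ‖fderiv ℝ u z‖ ^ q) ≤ ENNReal.ofReal (capCompact q K + η) :=
        ENNReal.ofReal_le_ofReal hlt.le
    _ ≤ ENNReal.ofReal (capCompact q K) + ENNReal.ofReal η := ENNReal.ofReal_add_le
    _ ≤ _ := by
      gcongr
      exact le_iSup_of_le K (le_iSup_of_le hK (le_iSup_of_le hKA le_rfl))

end CapacityCutoff

section CutoffConstruction

open Metric Set Filter Topology

variable {E : Type*} [NormedAddCommGroup E] [InnerProductSpace ℝ E] [FiniteDimensional ℝ E]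
  [MeasureSpace E] [BorelSpace E] [(volume : Measure E).IsAddHaarMeasure]

lemma exists_dilated_cutoff {q : ℝ} (hq : 1 < q) (hqn : q < Module.finrank ℝ E) (x : E) :
    ∃ C : ℝ, 0 ≤ C ∧ ∀ a δ η s : ℝ, a ≤ 0 → 0 < δ → 0 < η → 1 ≤ s → ∀ K A : Set E,
      IsCompact K → K ⊆ A → (∀ z ∈ K, s * (2 * δ) ≤ ‖z - x‖) →
      ∃ v : E → ℝ, (∃ L, LipschitzWith L v) ∧ v x = 0 ∧
        (∀ z, x + s • (z - x) ∈ K → 1 ≤ v z) ∧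
        weightedEnergy volume x a q v ≤ ENNReal.ofReal C *
          (ENNReal.ofReal ((δ ^ a) ^ q) * sobolevCapacity q A + ENNReal.ofReal η) := by
  obtain ⟨C, hC, hW⟩ := exists_weightedEnergy_innerCutoff_mul_le (volume : Measure E) hq hqn
  refine ⟨C, hC, fun a δ η s ha hδ hη hs K A hK hKA hd => ?_⟩
  have hs0 : 0 < s := by linarith
  have hb : 0 < (δ ^ a) ^ q := by positivity
  obtain ⟨u, ⟨L, hL⟩, hsupp, h1, hE⟩ :=
    exists_lipschitz_energy_le_sobolevCapacity (q := q) hK hKA (η := ((δ ^ a) ^ q)⁻¹ * η)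
      (by positivity)
  have hD : LipschitzWith s.toNNReal fun z => x + s • (z - x) :=
    LipschitzWith.of_dist_le_mul fun y z => by
      rw [dist_add_left, dist_smul₀, dist_sub_right, Real.norm_of_nonneg hs0.le,
        Real.coe_toNNReal _ hs0.le]
  let e : E ≃ₜ E := (Homeomorph.subRight x).trans
    ((Homeomorph.smulOfNeZero s hs0.ne').trans (Homeomorph.addLeft x))
  have hLip : LipschitzWith (L * s.toNNReal) fun z => u (x + s • (z - x)) := hL.comp hD
  have hcs : HasCompactSupport fun z => u (x + s • (z - x)) :=
    hsupp.comp_homeomorph e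
  refine ⟨fun z => innerCutoff x δ z * u (x + s • (z - x)),
    exists_lipschitzWith_innerCutoff_mul hδ hLip hcs, ?_, fun z hz => ?_, ?_⟩
  · simp only
    rw [innerCutoff_eq_zero hδ (by simpa using hδ.le), zero_mul]
  · have := hd _ hz
    rw [add_sub_cancel_left, norm_smul, Real.norm_of_nonneg hs0.le] at this
    simp only
    rw [innerCutoff_eq_one hδ (le_of_mul_le_mul_left this hs0), one_mul]
    exact h1 _ hz
  · calc _ ≤ ENNReal.ofReal (C * (δ ^ a) ^ q *
          ∫ z, ‖fderiv ℝ (fun z => u (x + s • (z - x))) z‖ ^ q) := hW _ _ hLip hcs _ _ _ ha hδ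
      _ ≤ ENNReal.ofReal (C * ((δ ^ a) ^ q * ∫ z, ‖fderiv ℝ u z‖ ^ q)) := by
          rw [mul_assoc]
          exact ENNReal.ofReal_le_ofReal (mul_le_mul_of_nonneg_left (mul_le_mul_of_nonneg_left
            (integral_norm_fderiv_dilation_le volume hqn.le hs u x) hb.le) hC)
      _ = ENNReal.ofReal C *
          (ENNReal.ofReal ((δ ^ a) ^ q) * ENNReal.ofReal (∫ z, ‖fderiv ℝ u z‖ ^ q)) := by
          rw [ENNReal.ofReal_mul hC, ENNReal.ofReal_mul hb.le]
      _ ≤ ENNReal.ofReal C * (ENNReal.ofReal ((δ ^ a) ^ q) *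
          (sobolevCapacity q A + ENNReal.ofReal (((δ ^ a) ^ q)⁻¹ * η))) := by gcongr
      _ = _ := by
          rw [mul_add (ENNReal.ofReal ((δ ^ a) ^ q)), ← ENNReal.ofReal_mul hb.le,
            mul_inv_cancel_left₀ hb.ne']

/-- Under the capacity condition there are Lipschitz cutoff functions equal to `1` at `x`, of
uniformly bounded weighted energy, supported near `U` up to small gaps between the shells. -/
lemma exists_cutoff_weightedEnergy_le {q a : ℝ} (hq : 1 < q) (hqn : q < Module.finrank ℝ E)
    (ha : a ≤ 0) {U : Set E} (hU : IsOpen U) (x : E)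
    (hT : ∑' n : ℕ, ENNReal.ofReal ((((1 / 2 : ℝ) ^ (n + 4)) ^ a) ^ q) * sobolevCapacity q
      ({z | (1 / 2 : ℝ) ^ (n + 2) < ‖z - x‖ ∧ ‖z - x‖ < (1 / 2 : ℝ) ^ (n + 1)} \ U) < ⊤) :
    ∃ B < (⊤ : ℝ≥0∞), ∀ (N : ℕ) (t : ℝ), 1 < t → t ^ 4 ≤ 2 →
      ∃ χ : E → ℝ, (∃ K, LipschitzWith K χ) ∧ (∀ z, 0 ≤ χ z) ∧ χ x = 1 ∧
        weightedEnergy volume x a q χ ≤ B ∧ (∀ z, 1 / 4 ≤ ‖z - x‖ → χ z = 0) ∧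
        (∀ n ≤ N, ∀ z ∉ U, t * (1 / 2 : ℝ) ^ (n + 2) ≤ ‖z - x‖ →
          ‖z - x‖ ≤ (1 / 2 : ℝ) ^ (n + 1) / t → χ z = 0) ∧
        ∀ z ∉ U, x + t ^ 2 • (z - x) ∉ U → (1 / 2 : ℝ) ^ (N + 2) < ‖z - x‖ → χ z = 0 := by
  have hq0 : 0 < q := by linarith
  obtain ⟨C, hC, hcut⟩ := exists_dilated_cutoff hq hqn x
  let Γ : ℕ → ℝ≥0∞ := fun n =>
    ENNReal.ofReal ((((1 / 2 : ℝ) ^ (n + 4)) ^ a) ^ q) * sobolevCapacity q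
      ({z | (1 / 2 : ℝ) ^ (n + 2) < ‖z - x‖ ∧ ‖z - x‖ < (1 / 2 : ℝ) ^ (n + 1)} \ U) +
    ENNReal.ofReal ((1 / 2 : ℝ) ^ n)
  have hS : ∑' n, ENNReal.ofReal C * Γ n < ⊤ := by
    rw [ENNReal.tsum_mul_left, ENNReal.tsum_add]
    exact ENNReal.mul_lt_top ENNReal.ofReal_lt_top
      (ENNReal.add_lt_top.2 ⟨hT, summable_geometric_two.tsum_ofReal_lt_top⟩)
  refine ⟨weightedEnergy volume x a q (innerCutoff x (1 / 8)) +
    ∑' n, ENNReal.ofReal C * Γ n + ∑' n, ENNReal.ofReal C * Γ n, ?_, fun N t ht ht4 => ?_⟩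
  · exact ENNReal.add_lt_top.2 ⟨ENNReal.add_lt_top.2
      ⟨weightedEnergy_innerCutoff_lt_top volume hq0 ha (by norm_num) x, hS⟩, hS⟩
  have ht0 : 0 < t := by linarith
  have ht2 : t ≤ 2 := by nlinarith [pow_pos ht0 3, one_le_pow₀ (n := 3) ht.le]
  let K : ℕ → Set E := fun n =>
    {z | t * (1 / 2 : ℝ) ^ (n + 2) ≤ ‖z - x‖ ∧ ‖z - x‖ ≤ (1 / 2 : ℝ) ^ (n + 1) / t} \ U
  have hKc : ∀ n, IsCompact (K n) := fun n => by
    refine (isCompact_closedBall x ((1 / 2 : ℝ) ^ (n + 1) / t)).of_isClosed_subset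
      (IsClosed.sdiff ?_ hU) fun z hz => by simpa [dist_eq_norm] using hz.1.2
    have hc : Continuous fun z : E => ‖z - x‖ := by fun_prop
    exact (isClosed_le continuous_const hc).inter (isClosed_le hc continuous_const)
  have hKA : ∀ n, K n ⊆
      {z | (1 / 2 : ℝ) ^ (n + 2) < ‖z - x‖ ∧ ‖z - x‖ < (1 / 2 : ℝ) ^ (n + 1)} \ U := by
    refine fun n z hz => ⟨⟨lt_of_lt_of_le ?_ hz.1.1, lt_of_le_of_lt hz.1.2 ?_⟩, hz.2⟩
    · exact lt_mul_of_one_lt_left (by positivity) ht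
    · exact div_lt_self (by positivity) ht
  have hKd : ∀ n, ∀ z ∈ K n, t ^ 2 * (2 * (1 / 2 : ℝ) ^ (n + 4)) ≤ ‖z - x‖ := fun n z hz => by
    refine le_trans ?_ hz.1.1
    have h0 : 0 < (1 / 2 : ℝ) ^ (n + 2) := by positivity
    rw [show (1 / 2 : ℝ) ^ (n + 4) = (1 / 2 : ℝ) ^ (n + 2) / 4 by rw [pow_add _ n 4, pow_add]; ring]
    nlinarith [mul_pos h0 ht0]
  have hex : ∀ s : ℝ, 1 ≤ s → s ≤ t ^ 2 → ∀ n, ∃ v : E → ℝ, (∃ L, LipschitzWith L v) ∧ v x = 0 ∧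
      (∀ z, x + s • (z - x) ∈ K n → 1 ≤ v z) ∧
      weightedEnergy volume x a q v ≤ ENNReal.ofReal C * Γ n := fun s hs hst n =>
    hcut a _ _ s ha (by positivity) (by positivity) hs _ _ (hKc n) (hKA n) fun z hz =>
      le_trans (by gcongr) (hKd n z hz)
  choose v hvL hvx hv1 hvE using hex 1 le_rfl (by nlinarith)
  choose w hwL hwx hw1 hwE using hex (t ^ 2) (by nlinarith) le_rfl
  obtain ⟨g, hgL, hg0, hgv, hgeq, hgE⟩ := exists_finset_max (μ := (volume : Measure E)) (x := x)
    (a := a) (q := q) (Finset.range (N + 1)) (innerCutoff x (1 / 8)) v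
    ⟨_, lipschitzWith_innerCutoff x (by norm_num)⟩ fun n _ => hvL n
  obtain ⟨h, ⟨L, hL⟩, hh0, hhw, hheq, hhE⟩ := exists_finset_max (μ := (volume : Measure E)) (x := x)
    (a := a) (q := q) (Finset.range (N + 1)) g w hgL fun n _ => hwL n
  have hgx : g x = 0 := by
    rcases hgeq x with e | ⟨n, -, e⟩
    · rw [e, innerCutoff_eq_zero (by norm_num) (by norm_num)]
    · rw [e, hvx]
  have hhx : h x = 0 := by
    rcases hheq x with e | ⟨n, -, e⟩
    · rw [e, hgx]
    · rw [e, hwx]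
  have hχ0 : ∀ z, 1 ≤ h z → max 0 (1 - h z) = 0 := fun z hz => max_eq_left (by linarith)
  have hv : ∀ n ≤ N, ∀ z ∈ K n, max 0 (1 - h z) = 0 := fun n hn z hz =>
    hχ0 z ((hv1 n z (by simpa using hz)).trans
      ((hgv n (Finset.mem_range.2 (by lia)) z).trans (hh0 z)))
  have hfar : ∀ z, 1 / 4 ≤ ‖z - x‖ → max 0 (1 - h z) = 0 := fun z hz =>
    hχ0 z (((innerCutoff_eq_one (by norm_num) (by linarith)).ge.trans (hg0 z)).trans (hh0 z))
  have hsub : LipschitzWith L fun z => 1 - h z := LipschitzWith.of_dist_le_mul fun y z => by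
    rw [Real.dist_eq, sub_sub_sub_cancel_left, ← Real.dist_eq, dist_comm]
    exact hL.dist_le_mul y z
  refine ⟨fun z => max 0 (1 - h z), ⟨L, hsub.const_max 0⟩, fun z => le_max_left _ _,
    by simp [hhx], ?_, hfar, fun n hn z hz h1 h2 => hv n hn z ⟨⟨h1, h2⟩, hz⟩, fun z hz hz2 hN => ?_⟩
  · calc weightedEnergy volume x a q (fun z => max 0 (1 - h z))
        ≤ weightedEnergy volume x a q (fun _ => (0 : ℝ)) +
          weightedEnergy volume x a q (fun z => 1 - h z) :=
          weightedEnergy_max_le (LipschitzWith.const 0) hsub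
      _ = weightedEnergy volume x a q h := by
          rw [weightedEnergy_const hq0, weightedEnergy_const_sub, zero_add]
      _ ≤ _ := by
          refine hhE.trans (add_le_add (hgE.trans (add_le_add le_rfl ?_)) ?_)
          · exact (Finset.sum_le_sum fun n _ => hvE n).trans (ENNReal.sum_le_tsum _)
          · exact (Finset.sum_le_sum fun n _ => hwE n).trans (ENNReal.sum_le_tsum _)
  · rcases le_or_gt (1 / 4) ‖z - x‖ with hz4 | hz4
    · exact hfar z hz4
    obtain ⟨n, hn, ⟨h1, h2⟩ | ⟨h1, h2⟩⟩ := exists_dyadic_interval ht ht4 N hz4 hN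
    · exact hv n hn z ⟨⟨h1, h2⟩, hz⟩
    · refine hχ0 z ((hw1 n z ⟨?_, hz2⟩).trans (hhw n (Finset.mem_range.2 (by lia)) z))
      simp only [mem_ofPred_eq, add_sub_cancel_left, norm_smul, norm_pow,
        Real.norm_of_nonneg ht0.le]
      exact ⟨h1, h2⟩

end CutoffConstruction

section ShellGaps

open Metric Set Filter Topology

variable {E : Type*} [NormedAddCommGroup E]

/-- The part of a ball around `x` left uncovered by slightly shrunken dyadic shells. -/
def shellGaps (x : E) (k : ℕ) : Set E :=
  {z | ‖z - x‖ ≤ 1 / 4 ∧ ∀ n ≤ k, ¬((1 + 1 / ((k : ℝ) + 8)) * (1 / 2 : ℝ) ^ (n + 2) ≤ ‖z - x‖ ∧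
    ‖z - x‖ ≤ (1 / 2 : ℝ) ^ (n + 1) / (1 + 1 / ((k : ℝ) + 8)))}

lemma antitone_shellGaps (x : E) : Antitone (shellGaps x) := by
  refine fun j k hjk z hz => ⟨hz.1, fun n hn h =>
    hz.2 n (hn.trans hjk) ⟨le_trans ?_ h.1, h.2.trans ?_⟩⟩
  all_goals gcongr

lemma measurableSet_shellGaps [MeasurableSpace E] [BorelSpace E] (x : E) (k : ℕ) :
    MeasurableSet (shellGaps x k) := by
  unfold shellGaps
  measurability

lemma tendsto_one_add_one_div_add_eight :
    Tendsto (fun k : ℕ => 1 + 1 / ((k : ℝ) + 8)) atTop (𝓝 1) := by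
  have := tendsto_atTop_add_const_right atTop (8 : ℝ) tendsto_natCast_atTop_atTop
  simpa using this.inv_tendsto_atTop.const_add 1

lemma iInter_shellGaps_subset (x : E) :
    ⋂ k, shellGaps x k ⊆ sphere x 0 ∪ ⋃ m : ℕ, sphere x ((1 / 2 : ℝ) ^ m) := by
  intro z hz
  rw [mem_iInter] at hz
  by_contra hn
  simp only [mem_union, mem_iUnion, mem_sphere_iff_norm, not_or, not_exists] at hn
  obtain ⟨h0, hm⟩ := hn
  have hr0 : 0 < ‖z - x‖ := lt_of_le_of_ne (norm_nonneg _) (Ne.symm h0)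
  have hr : ‖z - x‖ ≤ 1 / 4 := (hz 0).1
  obtain ⟨m, hm1, hm2⟩ := exists_nat_pow_near_of_lt_one hr0 (by linarith)
    (by norm_num : (0 : ℝ) < 1 / 2) (by norm_num)
  obtain ⟨n, rfl⟩ : ∃ n, m = n + 1 := by
    refine ⟨m - 1, (Nat.succ_pred_eq_of_ne_zero ?_).symm⟩
    rintro rfl
    norm_num at hm1
    linarith
  have hm2 := lt_of_le_of_ne hm2 (hm _)
  have ht := tendsto_one_add_one_div_add_eight
  have e1 : ∀ᶠ k : ℕ in atTop, (1 + 1 / ((k : ℝ) + 8)) * (1 / 2 : ℝ) ^ (n + 2) < ‖z - x‖ :=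
    (ht.mul_const _).eventually_lt_const (by simpa using hm1)
  have e2 : ∀ᶠ k : ℕ in atTop, ‖z - x‖ < (1 / 2 : ℝ) ^ (n + 1) / (1 + 1 / ((k : ℝ) + 8)) :=
    (tendsto_const_nhds.div ht one_ne_zero).eventually_const_lt (by simpa using hm2)
  obtain ⟨k, ⟨h1, h2⟩, hk⟩ := ((e1.and e2).and (eventually_ge_atTop n)).exists
  exact (hz k).2 n hk ⟨h1.le, h2.le⟩

lemma tendsto_measure_shellGaps [NormedSpace ℝ E] [MeasurableSpace E] [BorelSpace E]
    [FiniteDimensional ℝ E] [Nontrivial E] (μ : Measure E) [μ.IsAddHaarMeasure] (x : E) :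
    Tendsto (fun k => μ (shellGaps x k)) atTop (𝓝 0) := by
  have h0 : μ (⋂ k, shellGaps x k) = 0 := by
    refine measure_mono_null (iInter_shellGaps_subset x) (measure_union_null ?_ ?_)
    · exact Measure.addHaar_sphere μ x 0
    · exact measure_iUnion_null fun m => Measure.addHaar_sphere μ x _
  rw [← h0]
  refine tendsto_measure_iInter_atTop (fun k => (measurableSet_shellGaps x k).nullMeasurableSet)
    (antitone_shellGaps x) ⟨0, ((measure_mono ?_).trans_lt
      (isCompact_closedBall x (1 / 4)).measure_lt_top).ne⟩
  exact fun z hz => mem_closedBall_iff_norm.2 hz.1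

end ShellGaps

section PointEvaluation

open Metric Set Filter Topology

variable {d : ℕ}

/-- Hölder's inequality for the kernel of the reproducing formula tested against a cutoff. -/
lemma lintegral_cutoff_kernel_le {p q : ℝ} (hpq : p.HolderConjugate q) {a : ℝ}
    {f : EuclideanSpace ℂ (Fin d) → ℂ} {U V : Set (EuclideanSpace ℂ (Fin d))} (hU : IsOpen U)
    (hf : ContinuousOn f V) {χ : EuclideanSpace ℂ (Fin d) → ℝ} (hχ : Continuous χ)
    (hχ0 : ∀ z, 0 ≤ χ z) (hχV : tsupport χ ⊆ V) {M : ℝ≥0∞} (hM : ∀ z, χ z ≠ 0 → ‖f z‖ₑ ≤ M)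
    (x : EuclideanSpace ℂ (Fin d)) :
    ∫⁻ z, ‖f z‖ₑ * ‖fderiv ℝ χ z‖ₑ * ENNReal.ofReal (‖z - x‖ ^ a) ≤
      ((∫⁻ z in U, ‖f z‖ₑ ^ p) + M ^ p * volume (Function.support χ \ U)) ^ (1 / p) *
        weightedEnergy volume x a q χ ^ (1 / q) := by
  let O := Function.support χ
  have hO : IsOpen O := isOpen_ne_fun hχ continuous_const
  have hfO : AEMeasurable (O.indicator fun z => ‖f z‖ₑ) volume := by
    rw [aemeasurable_indicator_iff hO.measurableSet]
    exact ((hf.mono (subset_closure.trans hχV)).aemeasurable hO.measurableSet).enorm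
  calc ∫⁻ z, ‖f z‖ₑ * ‖fderiv ℝ χ z‖ₑ * ENNReal.ofReal (‖z - x‖ ^ a)
      = ∫⁻ z, (O.indicator (fun z => ‖f z‖ₑ) *
          fun z => ‖fderiv ℝ χ z‖ₑ * ENNReal.ofReal (‖z - x‖ ^ a)) z := by
        refine lintegral_congr fun z => ?_
        by_cases hz : χ z = 0
        · have h0 : ‖(0 : EuclideanSpace ℂ (Fin d) →L[ℝ] ℝ)‖ₑ = 0 := by
            rw [← ofReal_norm, norm_zero, ENNReal.ofReal_zero]
          simp only [Pi.mul_apply]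
          rw [fderiv_eq_zero_of_nonneg hχ0 hz, h0, mul_zero, zero_mul, mul_zero]
        · simp only [Pi.mul_apply]
          rw [indicator_of_mem (show z ∈ O from hz), mul_assoc]
    _ ≤ (∫⁻ z, O.indicator (fun z => ‖f z‖ₑ) z ^ p) ^ (1 / p) *
          weightedEnergy volume x a q χ ^ (1 / q) :=
        ENNReal.lintegral_mul_le_Lp_mul_Lq volume hpq hfO
          (measurable_weighted_fderiv x a χ).aemeasurable
    _ ≤ _ := by
        refine mul_le_mul' (ENNReal.rpow_le_rpow ?_ hpq.one_div_nonneg) le_rfl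
        calc ∫⁻ z, O.indicator (fun z => ‖f z‖ₑ) z ^ p
            = ∫⁻ z in O, ‖f z‖ₑ ^ p := by
              rw [← lintegral_indicator hO.measurableSet]
              refine lintegral_congr fun z => ?_
              by_cases hz : z ∈ O <;> simp [hz, hpq.pos]
          _ ≤ ∫⁻ z in U ∪ O \ U, ‖f z‖ₑ ^ p := lintegral_mono_set (by simp)
          _ ≤ (∫⁻ z in U, ‖f z‖ₑ ^ p) + ∫⁻ z in O \ U, ‖f z‖ₑ ^ p := lintegral_union_le _ _ _
          _ ≤ _ := by
              gcongr
              rw [← setLIntegral_const]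
              refine setLIntegral_mono' (hO.measurableSet.diff hU.measurableSet) fun z hz => ?_
              have := hpq.pos
              gcongr
              exact hM z hz.1

lemma capacity_weight_eq (d : ℕ) (q : ℝ) (n : ℕ) :
    (((1 / 2 : ℝ) ^ (n + 4)) ^ (1 - 2 * (d : ℝ))) ^ q =
      2 ^ (3 * (2 * (d : ℝ) - 1) * q) * 2 ^ (((n : ℝ) + 1) * (2 * (d : ℝ) - 1) * q) := by
  rw [one_div, inv_pow, ← Real.rpow_natCast, ← Real.rpow_neg two_pos.le, ← Real.rpow_mul two_pos.le,
    ← Real.rpow_mul two_pos.le, ← Real.rpow_add two_pos]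
  congr 1
  push_cast
  ring

lemma shell_succ_eq (x : EuclideanSpace ℂ (Fin d)) (n : ℕ) :
    shell x (n + 1) =
      {z | (1 / 2 : ℝ) ^ (n + 2) < ‖z - x‖ ∧ ‖z - x‖ < (1 / 2 : ℝ) ^ (n + 1)} := by
  have h : ∀ m : ℕ, (2 : ℝ) ^ (-(m : ℤ)) = (1 / 2 : ℝ) ^ m := fun m => by
    rw [zpow_neg, zpow_natCast, one_div, inv_pow]
  have h1 := h (n + 2)
  have h2 := h (n + 1)
  simp only [shell, dist_eq_norm]
  rw [← h1, ← h2]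
  push_cast
  simp only [add_assoc, one_add_one_eq_two]

/-- A uniform estimate `c ‖f x‖ ≤ (∫_U ‖f‖ ^ p) ^ (1 / p) B` in extended form. -/
lemma exists_enorm_le_lintegral_of_capacity_sum_lt_top (hd : 1 ≤ d)
    {U : Set (EuclideanSpace ℂ (Fin d))} (hUopen : IsOpen U) (hUbdd : Bornology.IsBounded U)
    {x : EuclideanSpace ℂ (Fin d)} (hx : x ∈ closure U) {p q : ℝ} (hpq : p.HolderConjugate q)
    (hqd : q < 2 * (d : ℝ))
    (hsum : ∑' n : ℕ,
        ENNReal.ofReal ((2 : ℝ) ^ (((n : ℝ) + 1) * (2 * (d:ℝ) - 1) * q)) *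
          sobolevCapacity q (shell x (n + 1) \ U) < ⊤) :
    ∃ c : ℝ, 0 < c ∧ ∃ B < (⊤ : ℝ≥0∞), ∀ f : EuclideanSpace ℂ (Fin d) → ℂ,
      (∃ V, IsOpen V ∧ closure U ⊆ V ∧ DifferentiableOn ℂ f V) →
      ENNReal.ofReal c * ‖f x‖ₑ ≤ (∫⁻ z in U, ‖f z‖ₑ ^ p) ^ (1 / p) * B := by
  have hd' : (1 : ℝ) ≤ d := by exact_mod_cast hd
  have hqn : q < Module.finrank ℝ (EuclideanSpace ℂ (Fin d)) := by
    rwa [finrank_real_euclideanSpace_complex]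
  have : Nontrivial (EuclideanSpace ℂ (Fin d)) := by
    refine Module.nontrivial_of_finrank_pos (R := ℝ) ?_
    exact_mod_cast hpq.symm.pos.trans hqn
  obtain ⟨c, hc, hrep⟩ := exists_pos_mul_enorm_le_lintegral d hd
  obtain ⟨B, hB, hcut⟩ := exists_cutoff_weightedEnergy_le (a := 1 - 2 * (d : ℝ)) hpq.symm.lt hqn
    (by linarith) hUopen x (by
      simp only [← shell_succ_eq, capacity_weight_eq]
      simp only [ENNReal.ofReal_mul (Real.rpow_nonneg two_pos.le _), mul_assoc (ENNReal.ofReal _)]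
      rw [ENNReal.tsum_mul_left]
      exact ENNReal.mul_lt_top ENNReal.ofReal_lt_top hsum)
  refine ⟨c, hc, B ^ (1 / q), ENNReal.rpow_lt_top_of_nonneg hpq.symm.one_div_nonneg hB.ne,
    fun f ⟨V, hV, hUV, hf⟩ => ?_⟩
  have hK : IsCompact (closure U) := hUbdd.isCompact_closure
  obtain ⟨ε, hε, hεV⟩ := hK.exists_cthickening_subset_open hV hUV
  obtain ⟨M, hM⟩ := hK.cthickening.exists_bound_of_continuousOn (hf.continuousOn.mono hεV)
  have hlim : Tendsto (fun k => ((∫⁻ z in U, ‖f z‖ₑ ^ p) +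
      ENNReal.ofReal M ^ p * volume (shellGaps x k)) ^ (1 / p) * B ^ (1 / q)) atTop
      (𝓝 ((∫⁻ z in U, ‖f z‖ₑ ^ p) ^ (1 / p) * B ^ (1 / q))) := by
    have h1 := ENNReal.Tendsto.const_mul (a := ENNReal.ofReal M ^ p)
      (tendsto_measure_shellGaps volume x)
      (Or.inr (ENNReal.rpow_ne_top_of_nonneg hpq.nonneg ENNReal.ofReal_ne_top))
    have h2 := h1.const_add (∫⁻ z in U, ‖f z‖ₑ ^ p)
    rw [mul_zero, add_zero] at h2
    exact ENNReal.Tendsto.mul_const ((ENNReal.continuous_rpow_const.tendsto _).comp h2)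
      (Or.inr (ENNReal.rpow_ne_top_of_nonneg hpq.symm.one_div_nonneg hB.ne))
  refine ge_of_tendsto hlim ?_
  have ht := tendsto_one_add_one_div_add_eight
  have e1 : ∀ᶠ k : ℕ in atTop, ((1 + 1 / ((k : ℝ) + 8)) ^ 2 - 1) * (1 / 4) < ε :=
    (((ht.pow 2).sub_const 1).mul_const (1 / 4)).eventually_lt_const (by simpa using hε)
  have e2 : ∀ᶠ k : ℕ in atTop, (1 / 2 : ℝ) ^ (k + 2) < ε :=
    ((tendsto_pow_atTop_nhds_zero_of_lt_one (by norm_num) (by norm_num)).comp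
      (tendsto_add_atTop_nat 2)).eventually_lt_const hε
  filter_upwards [e1, e2] with k hk1 hk2
  obtain ⟨t, htk⟩ : ∃ t : ℝ, t = 1 + 1 / ((k : ℝ) + 8) := ⟨_, rfl⟩
  have ht1 : 1 < t := by
    rw [htk]
    exact lt_add_of_pos_right 1 (by positivity)
  have ht98 : t ≤ 1 + 1 / (0 + 8) := by
    rw [htk]
    gcongr
    positivity
  rw [← htk] at hk1
  obtain ⟨χ, ⟨L, hL⟩, hχ0, hχx, hχE, hχfar, hχgap, hχD⟩ := hcut k t ht1
    ((pow_le_pow_left₀ (by linarith) ht98 4).trans (by norm_num))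
  have hnear : Function.support χ ⊆ cthickening ε (closure U) := by
    intro z hz
    rcases le_or_gt ‖z - x‖ ((1 / 2 : ℝ) ^ (k + 2)) with h | h
    · exact mem_cthickening_of_dist_le z x ε _ hx (by rw [dist_eq_norm]; linarith)
    by_cases hzU : z ∈ U
    · exact self_subset_cthickening _ (subset_closure hzU)
    have hDz : x + t ^ 2 • (z - x) ∈ U := by
      by_contra hDz
      exact hz (hχD z hzU hDz h)
    refine mem_cthickening_of_dist_le z _ ε _ (subset_closure hDz) ?_
    have h4 : ‖z - x‖ ≤ 1 / 4 := (not_le.1 fun h4 => hz (hχfar z h4)).le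
    have ht2 : 0 ≤ t ^ 2 - 1 := by nlinarith
    rw [dist_comm, dist_eq_norm,
      show x + t ^ 2 • (z - x) - z = (t ^ 2 - 1) • (z - x) by rw [sub_smul, one_smul]; abel,
      norm_smul, Real.norm_of_nonneg ht2]
    exact (mul_le_mul_of_nonneg_left h4 ht2).trans hk1.le
  have hts : tsupport χ ⊆ cthickening ε (closure U) := closure_minimal hnear isClosed_cthickening
  have hcs : HasCompactSupport χ := hK.cthickening.of_isClosed_subset (isClosed_tsupport χ) hts
  refine (hrep f V χ L x hV hf hL hcs (hts.trans hεV) hχx).trans ?_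
  refine (lintegral_cutoff_kernel_le hpq hUopen hf.continuousOn hL.continuous hχ0 (hts.trans hεV)
    (M := ENNReal.ofReal M) (fun z hz => ?_) x).trans ?_
  · rw [← ofReal_norm]
    exact ENNReal.ofReal_le_ofReal (hM z (hnear hz))
  · have hgap : Function.support χ \ U ⊆ shellGaps x k := fun z hz =>
      ⟨(not_le.1 fun h4 => hz.1 (hχfar z h4)).le, fun n hn h =>
        hz.1 (hχgap n hn z hz.2 (htk ▸ h.1) (htk ▸ h.2))⟩
    refine mul_le_mul' (ENNReal.rpow_le_rpow ?_ hpq.one_div_nonneg)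
      (ENNReal.rpow_le_rpow hχE hpq.symm.one_div_nonneg)
    gcongr

end PointEvaluation

/-- If `∑_{n≥1} 2^{n(2d-1)q} Γ_q(A_n(x) \ U) < ∞`, then there is `C > 0` with
`|f(x)| ≤ C (∫_U |f|^p dV)^{1/p}` for every `f` analytic on a neighborhood of `closure U`. -/
theorem boundedPointEvaluation_of_capacity_sum_lt_top
    (d : ℕ) (hd : 1 ≤ d) (U : Set (EuclideanSpace ℂ (Fin d)))
    (hUopen : IsOpen U) (hUconn : IsConnected U) (hUbdd : Bornology.IsBounded U)
    (x : EuclideanSpace ℂ (Fin d)) (hx : x ∈ closure U)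
    (p q : ℝ) (hp : 2 * (d:ℝ) / (2 * (d:ℝ) - 1) < p) (hq : q = p / (p - 1))
    (hsum : ∑' n : ℕ,
        ENNReal.ofReal ((2 : ℝ) ^ (((n : ℝ) + 1) * (2 * (d:ℝ) - 1) * q)) *
          sobolevCapacity q (shell x (n + 1) \ U) < ⊤) :
    ∃ C > 0, ∀ f : EuclideanSpace ℂ (Fin d) → ℂ,
      (∃ V, IsOpen V ∧ closure U ⊆ V ∧ DifferentiableOn ℂ f V) →
      ‖f x‖ ≤ C * (∫ z in U, ‖f z‖ ^ p) ^ (1 / p) := by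
  have hd' : (1 : ℝ) ≤ d := by exact_mod_cast hd
  have h2d : 0 < 2 * (d : ℝ) - 1 := by linarith
  have hp' : 2 * (d : ℝ) < p * (2 * (d : ℝ) - 1) := (div_lt_iff₀ h2d).1 hp
  have hp1 : 1 < p := by nlinarith
  have hpq : p.HolderConjugate q := hq ▸ .conjExponent hp1
  have hqd : q < 2 * (d : ℝ) := by
    rw [hq, div_lt_iff₀ (by linarith)]
    linarith
  obtain ⟨c, hc, B, hB, hcB⟩ :=
    exists_enorm_le_lintegral_of_capacity_sum_lt_top hd hUopen hUbdd hx hpq hqd hsum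
  refine ⟨B.toReal / c + 1, by positivity, fun f hf => ?_⟩
  have hmain := hcB f hf
  obtain ⟨V, hV, hUV, hfV⟩ := hf
  have hcont : ContinuousOn (fun z => ‖f z‖ ^ p) (closure U) :=
    (hfV.continuousOn.mono hUV).norm.rpow_const fun _ _ => Or.inr hpq.nonneg
  have hint : IntegrableOn (fun z => ‖f z‖ ^ p) U :=
    (hcont.integrableOn_compact hUbdd.isCompact_closure).mono_set subset_closure
  have hI0 : 0 ≤ ∫ z in U, ‖f z‖ ^ p := integral_nonneg fun z => by positivity
  have hI : ∫⁻ z in U, ‖f z‖ₑ ^ p = ENNReal.ofReal (∫ z in U, ‖f z‖ ^ p) := by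
    rw [ofReal_integral_eq_lintegral_ofReal hint (.of_forall fun z => by positivity)]
    refine lintegral_congr fun z => ?_
    rw [← ofReal_norm, ENNReal.ofReal_rpow_of_nonneg (norm_nonneg _) hpq.nonneg]
  rw [hI, ENNReal.ofReal_rpow_of_nonneg hI0 hpq.one_div_nonneg, ← ENNReal.ofReal_toReal hB.ne,
    ← ENNReal.ofReal_mul (by positivity), ← ofReal_norm, ← ENNReal.ofReal_mul hc.le,
    ENNReal.ofReal_le_ofReal_iff (by positivity)] at hmain
  calc ‖f x‖ ≤ (∫ z in U, ‖f z‖ ^ p) ^ (1 / p) * B.toReal / c := by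
        rw [le_div_iff₀ hc, mul_comm]
        exact hmain
    _ = B.toReal / c * (∫ z in U, ‖f z‖ ^ p) ^ (1 / p) := by ring
    _ ≤ (B.toReal / c + 1) * (∫ z in U, ‖f z‖ ^ p) ^ (1 / p) := by
        gcongr
        linarith
end

section
/- Let m ≥ 1 and let (φ_n)_{n∈ℕ} be a sequence of nonnegative Lipschitz functions on ℝ^m whose supports form a locally finite family (every point has a neighborhood meeting the supports of only finitely many φ_n). Let φ(z) = sup_n φ_n(z). Then φ is locally Lipschitz, and for almost every z ∈ ℝ^m (with respect to Lebesgue measure), φ and all φ_n are differentiable at z and |∇φ(z)| ≤ ∑_{n} |∇φ_n(z)|. -/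
open MeasureTheory Filter
open scoped Topology NNReal

/-- **Rademacher's theorem** for locally Lipschitz functions. -/
theorem LocallyLipschitz.ae_differentiableAt {E F : Type*}
    [NormedAddCommGroup E] [NormedSpace ℝ E] [FiniteDimensional ℝ E]
    [MeasurableSpace E] [BorelSpace E]
    [NormedAddCommGroup F] [NormedSpace ℝ F] [FiniteDimensional ℝ F]
    {μ : Measure E} [μ.IsAddHaarMeasure] {f : E → F} (hf : LocallyLipschitz f) :
    ∀ᵐ x ∂μ, DifferentiableAt ℝ f x := by
  refine measure_null_of_locally_null _ fun x _ => ?_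
  obtain ⟨K, t, ht, hK⟩ := hf x
  refine ⟨interior t ∩ {y | ¬ DifferentiableAt ℝ f y}, ?_, ?_⟩
  · exact inter_mem (mem_nhdsWithin_of_mem_nhds (interior_mem_nhds.2 ht)) self_mem_nhdsWithin
  · refine measure_mono_null ?_ (ae_iff.1 (hK.ae_differentiableWithinAt_of_mem (μ := μ)))
    rintro y ⟨hy, hd⟩ h
    exact hd ((h (interior_subset hy)).differentiableAt (mem_interior_iff_mem_nhds.1 hy))

/-- If two real families vanish outside a common finite set of indices, their suprema differ by
at most the sum of the termwise distances. -/
theorem abs_iSup_sub_iSup_le_sum {ι : Type*} [Nonempty ι] {a b : ι → ℝ} {s : Finset ι}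
    (ha : ∀ i ∉ s, a i = 0) (hb : ∀ i ∉ s, b i = 0) :
    |(⨆ i, a i) - ⨆ i, b i| ≤ ∑ i ∈ s, |a i - b i| := by
  have bdd : ∀ c : ι → ℝ, (∀ i ∉ s, c i = 0) → BddAbove (Set.range c) := fun c hc =>
    ⟨∑ i ∈ s, |c i|, by
      rintro _ ⟨i, rfl⟩
      by_cases hi : i ∈ s
      · exact (le_abs_self _).trans
          (Finset.single_le_sum (f := fun i => |c i|) (fun _ _ => abs_nonneg _) hi)
      · rw [hc i hi]
        exact Finset.sum_nonneg fun _ _ => abs_nonneg _⟩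
  have key : ∀ i, |a i - b i| ≤ ∑ i ∈ s, |a i - b i| := fun i => by
    by_cases hi : i ∈ s
    · exact Finset.single_le_sum (f := fun i => |a i - b i|) (fun _ _ => abs_nonneg _) hi
    · rw [ha i hi, hb i hi, sub_self, abs_zero]
      exact Finset.sum_nonneg fun _ _ => abs_nonneg _
  have hA : (⨆ i, a i) ≤ (⨆ i, b i) + ∑ i ∈ s, |a i - b i| := ciSup_le fun i => by
    linarith [le_ciSup (bdd b hb) i, key i, le_abs_self (a i - b i)]
  have hB : (⨆ i, b i) ≤ (⨆ i, a i) + ∑ i ∈ s, |a i - b i| := ciSup_le fun i => by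
    linarith [le_ciSup (bdd a ha) i, key i, neg_abs_le (a i - b i)]
  rw [abs_le]
  constructor <;> linarith

/-- If the increments of `f` at `x` are bounded by the sum of the increments of the `g i`, then
the derivative of `f` at `x` is bounded by the sum of the derivatives. -/
theorem norm_fderiv_le_sum_norm_fderiv {ι E F G : Type*}
    [NormedAddCommGroup E] [NormedSpace ℝ E] [NormedAddCommGroup F] [NormedSpace ℝ F]
    [NormedAddCommGroup G] [NormedSpace ℝ G]
    {f : E → F} {g : ι → E → G} {s : Finset ι} {x : E} (hf : DifferentiableAt ℝ f x)
    (hg : ∀ i ∈ s, DifferentiableAt ℝ (g i) x)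
    (h : ∀ᶠ y in 𝓝 x, ‖f y - f x‖ ≤ ∑ i ∈ s, ‖g i y - g i x‖) :
    ‖fderiv ℝ f x‖ ≤ ∑ i ∈ s, ‖fderiv ℝ (g i) x‖ := by
  refine ContinuousLinearMap.opNorm_le_bound _ (Finset.sum_nonneg fun _ _ => norm_nonneg _)
    fun v => ?_
  have h₁ := (hf.hasFDerivAt.hasLineDerivAt v).tendsto_slope_zero.norm
  have h₂ := tendsto_finsetSum s fun i hi =>
    ((hg i hi).hasFDerivAt.hasLineDerivAt v).tendsto_slope_zero.norm
  have hline : Tendsto (fun t : ℝ => x + t • v) (𝓝[≠] 0) (𝓝 x) := by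
    refine Tendsto.mono_left ?_ nhdsWithin_le_nhds
    exact (by fun_prop : Continuous fun t : ℝ => x + t • v).tendsto' 0 x (by simp)
  calc ‖fderiv ℝ f x v‖ ≤ ∑ i ∈ s, ‖fderiv ℝ (g i) x v‖ := by
        refine le_of_tendsto_of_tendsto h₁ h₂ ?_
        filter_upwards [hline.eventually h] with t ht
        simp only [norm_smul, ← Finset.mul_sum]
        exact mul_le_mul_of_nonneg_left ht (norm_nonneg _)
    _ ≤ (∑ i ∈ s, ‖fderiv ℝ (g i) x‖) * ‖v‖ := by
        rw [Finset.sum_mul]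
        exact Finset.sum_le_sum fun i _ => ContinuousLinearMap.le_opNorm _ _

/-- Near a given point, a locally finite family vanishes outside a finite set of indices. -/
theorem LocallyFinite.exists_finset_forall_notMem_eq_zero {ι X M : Type*} [TopologicalSpace X]
    [Zero M] {φ : ι → X → M} (hφ : LocallyFinite fun i => Function.support (φ i)) (x : X) :
    ∃ s : Finset ι, ∃ U ∈ 𝓝 x, ∀ y ∈ U, ∀ i ∉ s, φ i y = 0 := by
  obtain ⟨U, hU, hfin⟩ := hφ x
  refine ⟨hfin.toFinset, U, hU, fun y hy i hi => ?_⟩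
  by_contra h
  exact hi (hfin.mem_toFinset.2 ⟨y, h, hy⟩)

/-- The supremum of a locally finite family of Lipschitz functions is locally Lipschitz. -/
theorem LocallyFinite.locallyLipschitz_iSup {ι X : Type*} [Nonempty ι] [PseudoMetricSpace X]
    {φ : ι → X → ℝ} (hφ : LocallyFinite fun i => Function.support (φ i))
    (hLip : ∀ i, ∃ L, LipschitzWith L (φ i)) : LocallyLipschitz fun x => ⨆ i, φ i x := by
  intro x
  choose L hL using hLip
  obtain ⟨s, U, hU, hs⟩ := hφ.exists_finset_forall_notMem_eq_zero x
  refine ⟨∑ i ∈ s, L i, U, hU, LipschitzOnWith.of_dist_le_mul fun y hy z hz => ?_⟩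
  rw [Real.dist_eq, NNReal.coe_sum, Finset.sum_mul]
  exact (abs_iSup_sub_iSup_le_sum (hs y hy) (hs z hz)).trans
    (Finset.sum_le_sum fun i _ => (hL i).dist_le_mul y z)

/-- Let `(φ_n)` be nonnegative Lipschitz functions on `ℝ^m` whose supports form a locally
finite family, and let `φ = sup_n φ_n`.  Then `φ` is locally Lipschitz and, for almost every
`z`, `φ` and all the `φ_n` are differentiable at `z` and `|∇φ(z)| ≤ ∑_n |∇φ_n(z)|`. -/
theorem locallyLipschitz_iSup_and_ae_gradNorm_le
    (m : ℕ) (hm : 1 ≤ m) (φ : ℕ → EuclideanSpace ℝ (Fin m) → ℝ)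
    (hLip : ∀ n, ∃ L, LipschitzWith L (φ n))
    (hnonneg : ∀ n z, 0 ≤ φ n z)
    (hlf : LocallyFinite fun n => Function.support (φ n)) :
    LocallyLipschitz (fun z => ⨆ n, φ n z) ∧
    ∀ᵐ z, DifferentiableAt ℝ (fun z => ⨆ n, φ n z) z ∧
      (∀ n, DifferentiableAt ℝ (φ n) z) ∧
      ‖fderiv ℝ (fun z => ⨆ n, φ n z) z‖ ≤ ∑' n, ‖fderiv ℝ (φ n) z‖ := by
  have hsup := hlf.locallyLipschitz_iSup hLip
  refine ⟨hsup, ?_⟩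
  have hdiff : ∀ᵐ z, ∀ n, DifferentiableAt ℝ (φ n) z :=
    ae_all_iff.2 fun n => (hLip n).choose_spec.ae_differentiableAt
  filter_upwards [hsup.ae_differentiableAt (μ := volume), hdiff] with z hz hzn
  refine ⟨hz, hzn, ?_⟩
  obtain ⟨s, U, hU, hs⟩ := hlf.exists_finset_forall_notMem_eq_zero z
  have hzero : ∀ n ∉ s, ‖fderiv ℝ (φ n) z‖ = 0 := fun n hn => by
    have heq : φ n =ᶠ[𝓝 z] fun _ => 0 := by
      filter_upwards [hU] with y hy using hs y hy n hn
    simp [heq.fderiv_eq]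
  rw [tsum_eq_sum hzero]
  refine norm_fderiv_le_sum_norm_fderiv hz (fun n _ => hzn n) ?_
  filter_upwards [hU] with y hy
  exact abs_iSup_sub_iSup_le_sum (hs y hy) (hs z (mem_of_mem_nhds hU))
end
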